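/- There exists an absolute constant C such that the following holds. Let D = ×_{i=1}^n D_i and D̂ = ×_{i=1}^n D̂_i be product distributions with each D_i and D̂_i supported on [0,H]^m, and suppose ‖D_i − D̂_i‖_{TV} ≤ ε for every i. Then |OPT(D) − OPT(D̂)| ≤ C·nmLH·(nε + √(nε)), where OPT denotes the optimal revenue over BIC and IR mechanisms. -/

import Mathlib

open MeasureTheory Set

namespace MultiItem

/-- Feasible deterministic allocations of `m` items to `n` bidders: each item goes to at
most one bidder. -/
def Alloc (n m : ℕ) : Type :=
  {x : Fin n → Fin m → Bool // ∀ j : Fin m, (Finset.univ.filter fun i => x i j = true).card ≤ 1}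

instance (n m : ℕ) : Fintype (Alloc n m) := by
  unfold Alloc; infer_instance

instance (n m : ℕ) : DecidableEq (Alloc n m) := by
  unfold Alloc; infer_instance

/-- The empty allocation: nobody gets anything. -/
def emptyAlloc (n m : ℕ) : Alloc n m :=
  ⟨fun _ _ => false, by intro j; simp⟩

/-- Measurable-space structure on `Option α`: a set is measurable iff its preimage under
`some` is measurable. -/
instance {α : Type*} [m₀ : MeasurableSpace α] : MeasurableSpace (Option α) :=
  MeasurableSpace.map some m₀

/-- A (randomized) multi-item mechanism, represented by the distribution over allocations
and the expected payments induced on each bid profile; the bid `none` is the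
non-participation symbol `⊥`, which results in the empty allocation and zero payments. -/
structure Mechanism (n m : ℕ) where
  allocProb : (Fin n → Option (Fin m → ℝ)) → Alloc n m → ℝ
  pay : (Fin n → Option (Fin m → ℝ)) → Fin n → ℝ
  allocProb_nonneg : ∀ b x, 0 ≤ allocProb b x
  allocProb_sum_one : ∀ b, ∑ x : Alloc n m, allocProb b x = 1
  optOut : ∀ b, (∃ i, b i = none) →
    (allocProb b = fun x => if x = emptyAlloc n m then 1 else 0) ∧ pay b = fun _ => 0
  meas_allocProb : ∀ x, Measurable fun b => allocProb b x
  meas_pay : ∀ i, Measurable fun b => pay b i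

variable {n m : ℕ}

/-- Expected utility of bidder `i` with type `t` under bid profile `b`, for the valuation
profile `v`. -/
def util (v : Fin n → (Fin m → ℝ) → Alloc n m → ℝ) (M : Mechanism n m)
    (i : Fin n) (t : Fin m → ℝ) (b : Fin n → Option (Fin m → ℝ)) : ℝ :=
  (∑ x : Alloc n m, M.allocProb b x * v i t x) - M.pay b i

/-- (Ex-post) individual rationality on type profiles from `[0,H]^m`. -/
def IsIR (H : ℝ) (v : Fin n → (Fin m → ℝ) → Alloc n m → ℝ) (M : Mechanism n m) : Prop :=
  ∀ t : Fin n → Fin m → ℝ, (∀ i j, t i j ∈ Icc (0:ℝ) H) →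
    ∀ i, 0 ≤ util v M i (t i) fun j => some (t j)

/-- Interim expected utility of bidder `i` with type `t` bidding `bid`, when all other
bidders bid their true types drawn from `D`. -/
noncomputable def interim (v : Fin n → (Fin m → ℝ) → Alloc n m → ℝ) (M : Mechanism n m)
    (D : Fin n → Measure (Fin m → ℝ)) (i : Fin n) (t : Fin m → ℝ)
    (bid : Option (Fin m → ℝ)) : ℝ :=
  ∫ b, util v M i t (fun j => if j = i then bid else some (b j)) ∂(Measure.pi D)

/-- The (topological) support of a measure. -/
def msupport {α : Type*} [TopologicalSpace α] [MeasurableSpace α] (μ : Measure α) : Set α :=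
  {x | ∀ U : Set α, IsOpen U → x ∈ U → 0 < μ U}

/-- `η`-Bayesian incentive compatibility w.r.t. the product of the `D i` (misreports range
over types in `[0,H]^m` and the non-participation bid `⊥`). -/
def IsBIC (η H : ℝ) (v : Fin n → (Fin m → ℝ) → Alloc n m → ℝ)
    (M : Mechanism n m) (D : Fin n → Measure (Fin m → ℝ)) : Prop :=
  ∀ i : Fin n, ∀ t ∈ msupport (D i), ∀ bid : Option (Fin m → ℝ),
    (∀ s ∈ bid, ∀ j, s j ∈ Icc (0:ℝ) H) →
    interim v M D i t bid ≤ interim v M D i t (some t) + η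

/-- Expected revenue under truthful bidding from `D`. -/
noncomputable def RevT (M : Mechanism n m) (D : Fin n → Measure (Fin m → ℝ)) : ℝ :=
  ∫ b, (∑ i, M.pay (fun j => some (b j)) i) ∂(Measure.pi D)

/-- Optimal revenue over `η`-BIC and IR mechanisms. -/
noncomputable def OPT (η H : ℝ) (v : Fin n → (Fin m → ℝ) → Alloc n m → ℝ)
    (D : Fin n → Measure (Fin m → ℝ)) : ℝ :=
  sSup {r | ∃ M : Mechanism n m, IsIR H v M ∧ IsBIC η H v M D ∧ r = RevT M D}

/-- The distribution is supported on the box `[0,H]^m`. -/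
def suppBox (H : ℝ) (μ : Measure (Fin m → ℝ)) : Prop :=
  μ {t | ∀ j, t j ∈ Icc (0:ℝ) H} = 1

/-- The total variation distance between `P` and `Q` is at most `ε`. -/
def TVLe {α : Type*} [MeasurableSpace α] (P Q : Measure α) (ε : ℝ) : Prop :=
  ∀ A : Set α, MeasurableSet A → |(P A).toReal - (Q A).toReal| ≤ ε

/-- The total variation distance between two measures. -/
noncomputable def tvDist {α : Type*} [MeasurableSpace α] (P Q : Measure α) : ℝ :=
  sSup {r | ∃ A : Set α, MeasurableSet A ∧ r = |(P A).toReal - (Q A).toReal|}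

/-- The Prokhorov distance (w.r.t. the `ℓ1` metric) between `P` and `Q` is at most `ε`. -/
def ProkhorovLe {k : ℕ} (P Q : Measure (Fin k → ℝ)) (ε : ℝ) : Prop :=
  ∀ ε' : ℝ, ε < ε' → ∀ A : Set (Fin k → ℝ), MeasurableSet A →
    P A ≤ Q {x | ∃ y ∈ A, (∑ j, |x j - y j|) < ε'} + ENNReal.ofReal ε' ∧
    Q A ≤ P {x | ∃ y ∈ A, (∑ j, |x j - y j|) < ε'} + ENNReal.ofReal ε'

/-- Round `x ≥ 0` down to the grid `{0} ∪ {ℓ + i·δ : i ∈ ℤ≥0}`. -/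
noncomputable def roundPt (ℓ δ x : ℝ) : ℝ :=
  if x < ℓ then 0 else ℓ + ⌊(x - ℓ) / δ⌋ * δ

/-- The pushforward `⌊F⌋_{ℓ,δ}` of a distribution under coordinatewise rounding. -/
noncomputable def roundMeasure {k : ℕ} (ℓ : Fin k → ℝ) (δ : ℝ)
    (F : Measure (Fin k → ℝ)) : Measure (Fin k → ℝ) :=
  F.map fun x j => roundPt (ℓ j) δ (x j)

end MultiItem

open MultiItem


open MeasureTheory Set
namespace MIAux
set_option linter.unusedSectionVars false
open ProbabilityTheory

/-- Fubini for products of functions (lintegral, probability measures). -/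
lemma lintegral_pi_prod {ι T : Type*} [Fintype ι] [MeasurableSpace T]
    (μ : ι → Measure T) [∀ i, IsProbabilityMeasure (μ i)] (f : ι → T → ENNReal)
    (hf : ∀ i, Measurable (f i)) :
    ∫⁻ b, ∏ i, f i (b i) ∂(Measure.pi μ) = ∏ i, ∫⁻ t, f i t ∂(μ i) := by
  have h1 : iIndepFun (fun i (b : ι → T) => f i (b i)) (Measure.pi μ) :=
    iIndepFun_pi (X := f) (fun i => (hf i).aemeasurable)
  have h2 := lintegral_prod_eq_prod_lintegral_of_indepFun Finset.univ _ h1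
    (fun i => (hf i).comp (measurable_pi_apply i))
  rw [h2]
  refine Finset.prod_congr rfl fun i _ => ?_
  have := (measurePreserving_eval μ i).lintegral_comp (hf i)
  simpa using this

variable {ι T : Type*} [Fintype ι] [DecidableEq ι] [MeasurableSpace T]

lemma measurable_upd (i : ι) :
    Measurable (fun p : T × (ι → T) => Function.update p.2 i p.1) := by
  refine measurable_pi_iff.2 fun j => ?_
  by_cases h : j = i
  · subst h; simpa using measurable_fst
  · simp only [Function.update_of_ne h]
    exact (measurable_pi_apply j).comp measurable_snd

lemma measurable_upd_left (i : ι) (s : T) :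
    Measurable (fun b : ι → T => Function.update b i s) :=
  (measurable_upd i).comp (measurable_const.prodMk measurable_id)

lemma map_upd (D : ι → Measure T) [∀ i, IsProbabilityMeasure (D i)] (i : ι)
    (ν : Measure T) [IsFiniteMeasure ν] :
    (ν.prod (Measure.pi D)).map (fun p => Function.update p.2 i p.1)
      = Measure.pi (Function.update D i ν) := by
  have : ∀ j, IsFiniteMeasure (Function.update D i ν j) := by
    intro j
    by_cases h : j = i
    · subst h; simpa
    · simp only [Function.update_of_ne h]; infer_instance
  symm
  refine Measure.pi_eq fun S hS => ?_
  rw [Measure.map_apply (measurable_upd i) (MeasurableSet.univ_pi hS)]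
  have : (fun p : T × (ι → T) => Function.update p.2 i p.1) ⁻¹' (Set.pi univ S)
      = S i ×ˢ Set.pi univ (Function.update S i univ) := by
    ext ⟨s, b⟩
    simp only [mem_preimage, Set.mem_pi, mem_univ, true_imp_iff, mem_prod]
    constructor
    · intro h
      refine ⟨by simpa using h i, fun j => ?_⟩
      by_cases hj : j = i
      · subst hj; simp
      · simpa [hj] using h j
    · rintro ⟨h1, h2⟩ j
      by_cases hj : j = i
      · subst hj; simpa using h1
      · simpa [hj] using h2 j
  rw [this, Measure.prod_prod, Measure.pi_pi]
  rw [← Finset.mul_prod_erase _ _ (Finset.mem_univ i),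
    ← Finset.mul_prod_erase Finset.univ (fun j => (Function.update D i ν j) (S j))
      (Finset.mem_univ i)]
  simp only [Function.update_self, measure_univ, one_mul]
  congr 1
  refine Finset.prod_congr rfl fun j hj => ?_
  simp [Function.update_of_ne (Finset.ne_of_mem_erase hj)]

lemma map_upd_self (D : ι → Measure T) [∀ i, IsProbabilityMeasure (D i)] (i : ι) :
    ((D i).prod (Measure.pi D)).map (fun p => Function.update p.2 i p.1) = Measure.pi D := by
  rw [map_upd]; simp

lemma integrable_upd (D : ι → Measure T) [∀ i, IsProbabilityMeasure (D i)] (i : ι)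
    (F : (ι → T) → ℝ) (hF : Integrable F (Measure.pi D)) :
    Integrable (fun p : T × (ι → T) => F (Function.update p.2 i p.1))
      ((D i).prod (Measure.pi D)) := by
  rw [← map_upd_self D i] at hF
  exact hF.comp_measurable (measurable_upd i)

lemma integral_upd (D : ι → Measure T) [∀ i, IsProbabilityMeasure (D i)] (i : ι)
    (F : (ι → T) → ℝ) (hF : Integrable F (Measure.pi D)) :
    ∫ b, F b ∂(Measure.pi D) = ∫ s, ∫ b, F (Function.update b i s) ∂(Measure.pi D) ∂(D i) := by
  have h := integrable_upd D i F hF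
  rw [← integral_prod _ h]
  have h3 := hF
  rw [← map_upd_self D i] at h3
  conv_lhs => rw [← map_upd_self D i]
  rw [integral_map (measurable_upd i).aemeasurable h3.aestronglyMeasurable]

lemma integral_upd' (D : ι → Measure T) [∀ i, IsProbabilityMeasure (D i)] (i : ι)
    (ν : Measure T) [IsFiniteMeasure ν]
    (F : (ι → T) → ℝ) (hF : Measurable F) (c : ℝ) (hc : ∀ b, |F b| ≤ c) :
    ∫ b, F b ∂(Measure.pi (Function.update D i ν))
      = ∫ s, ∫ b, F (Function.update b i s) ∂(Measure.pi D) ∂ν := by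
  have hm : Measurable (fun p : T × (ι → T) => F (Function.update p.2 i p.1)) :=
    hF.comp (measurable_upd i)
  have h : Integrable (fun p : T × (ι → T) => F (Function.update p.2 i p.1))
      (ν.prod (Measure.pi D)) :=
    Integrable.of_bound hm.aestronglyMeasurable c (Filter.Eventually.of_forall fun p => hc _)
  rw [← integral_prod _ h, ← map_upd,
    integral_map (measurable_upd i).aemeasurable hF.aestronglyMeasurable]

/-- `G + ∑ N_k ≤ 1`. -/
lemma atMostOne_le (s : Finset ι) (g : ι → ℝ) (h0 : ∀ i, 0 ≤ g i) (h1 : ∀ i, g i ≤ 1) :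
    ∏ j ∈ s, g j + ∑ k ∈ s, (1 - g k) * ∏ j ∈ s.erase k, g j ≤ 1 := by
  induction s using Finset.induction_on with
  | empty => simp
  | insert a s ha ih =>
    rw [Finset.prod_insert ha, Finset.sum_insert ha, Finset.erase_insert ha]
    have : ∑ k ∈ s, (1 - g k) * ∏ j ∈ (insert a s).erase k, g j
        = g a * ∑ k ∈ s, (1 - g k) * ∏ j ∈ s.erase k, g j := by
      rw [Finset.mul_sum]
      refine Finset.sum_congr rfl fun k hk => ?_
      have hak : a ≠ k := fun h => ha (h ▸ hk)
      rw [Finset.erase_insert_of_ne hak, Finset.prod_insert (by simp [ha])]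
      ring
    rw [this]
    have hQ : 0 ≤ ∑ k ∈ s, (1 - g k) * ∏ j ∈ s.erase k, g j :=
      Finset.sum_nonneg fun k _ => mul_nonneg (by linarith [h1 k])
        (Finset.prod_nonneg fun j _ => h0 j)
    nlinarith [h0 a, h1 a]

lemma one_sub_sum_le_prod (s : Finset ι) (β : ι → ℝ) (h0 : ∀ i, 0 ≤ β i) (h1 : ∀ i, β i ≤ 1) :
    1 - ∑ j ∈ s, β j ≤ ∏ j ∈ s, (1 - β j) := by
  induction s using Finset.induction_on with
  | empty => simp
  | insert a s ha ih =>
    rw [Finset.prod_insert ha, Finset.sum_insert ha]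
    have hQ : 0 ≤ ∑ j ∈ s, β j := Finset.sum_nonneg fun k _ => h0 k
    have hP : ∏ j ∈ s, (1 - β j) ≤ 1 := Finset.prod_le_one (fun j _ => by linarith [h1 j])
      (fun j _ => by linarith [h0 j])
    nlinarith [h0 a, h1 a]

/-- TV decomposition. -/
lemma tv_decomp (P Q : Measure T) [IsProbabilityMeasure P] [IsProbabilityMeasure Q] (ε : ℝ)
    (h : ∀ A : Set T, MeasurableSet A → |(P A).toReal - (Q A).toReal| ≤ ε)
    (S : Set T) (hS : MeasurableSet S) (hPS : P Sᶜ = 0) :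
    ∃ (R : Measure T) (g : T → ℝ), Measurable g ∧ (∀ t, 0 ≤ g t) ∧ (∀ t, g t ≤ 1) ∧
      (∀ t ∉ S, g t = 0) ∧ P = Q.withDensity (fun t => ENNReal.ofReal (g t)) + R ∧
      (R univ).toReal ≤ ε := by
  obtain ⟨s, hs, h1, h2⟩ := hahn_decomposition Q P
  set C := P.restrict s + Q.restrict sᶜ with hC
  have hCQ : C ≤ Q := by
    conv_rhs => rw [← Measure.restrict_add_restrict_compl (μ := Q) hs]
    refine add_le_add ?_ le_rfl
    refine Measure.le_iff.2 fun t ht => ?_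
    rw [Measure.restrict_apply ht, Measure.restrict_apply ht]
    exact h1 _ (ht.inter hs) inter_subset_right
  have hQP : Q.restrict sᶜ ≤ P.restrict sᶜ := by
    refine Measure.le_iff.2 fun t ht => ?_
    rw [Measure.restrict_apply ht, Measure.restrict_apply ht]
    exact h2 _ (ht.inter hs.compl) inter_subset_right
  have hCP : C ≤ P := by
    conv_rhs => rw [← Measure.restrict_add_restrict_compl (μ := P) hs]
    exact add_le_add le_rfl hQP
  have : IsFiniteMeasure C := by rw [hC]; infer_instance
  set R := P - C with hR
  have hPCR : P = C + R := by rw [hR, add_comm, Measure.sub_add_cancel_of_le hCP]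
  have hac : C ≪ Q := Measure.absolutelyContinuous_of_le hCQ
  have hle : C.rnDeriv Q ≤ᵐ[Q] 1 := Measure.rnDeriv_le_one_of_le hCQ
  refine ⟨R, S.indicator (fun t => min 1 (C.rnDeriv Q t).toReal), ?_, ?_, ?_, ?_, ?_, ?_⟩
  · exact (measurable_const.min (Measure.measurable_rnDeriv C Q).ennreal_toReal).indicator hS
  · intro t
    exact indicator_nonneg (fun t _ => le_min zero_le_one ENNReal.toReal_nonneg) t
  · intro t
    by_cases hts : t ∈ S
    · simp only [indicator_of_mem hts]; exact min_le_left _ _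
    · simp [hts]
  · intro t ht; simp [ht]
  · conv_lhs => rw [hPCR]
    congr 1
    have hCS : C Sᶜ = 0 := le_antisymm ((hCP Sᶜ).trans hPS.le) zero_le
    have e1 : C = C.restrict S := by
      rw [Measure.restrict_eq_self_of_ae_mem]
      exact hCS
    have e2 : C = Q.withDensity (S.indicator (C.rnDeriv Q)) := by
      conv_lhs => rw [e1, ← Measure.withDensity_rnDeriv_eq C Q hac]
      rw [withDensity_indicator hS, restrict_withDensity hS]
    conv_lhs => rw [e2]
    refine withDensity_congr_ae ?_
    filter_upwards [hle] with t ht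
    by_cases hts : t ∈ S
    · simp only [indicator_of_mem hts]
      have hne : C.rnDeriv Q t ≠ ⊤ := (ht.trans_lt ENNReal.one_lt_top).ne
      have : (C.rnDeriv Q t).toReal ≤ 1 := by
        simpa using ENNReal.toReal_mono ENNReal.one_ne_top ht
      rw [min_eq_right this, ENNReal.ofReal_toReal hne]
    · simp [hts]
  · have : (R univ).toReal = (P sᶜ).toReal - (Q sᶜ).toReal := by
      have h3 : (P univ).toReal = (C univ).toReal + (R univ).toReal := by
        conv_lhs => rw [hPCR]
        rw [Measure.add_apply, ENNReal.toReal_add (by finiteness) (by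
          rw [hR]; finiteness)]
      have h4 : (C univ).toReal = (P s).toReal + (Q sᶜ).toReal := by
        rw [hC, Measure.add_apply, ENNReal.toReal_add (by finiteness) (by finiteness)]
        simp
      have h5 : (P univ).toReal = (P s).toReal + (P sᶜ).toReal := by
        rw [← measure_add_measure_compl hs, ENNReal.toReal_add (by finiteness) (by finiteness)]
      linarith
    rw [this]
    exact (le_abs_self _).trans (h _ hs.compl)

end MIAux

open MeasureTheory Set
namespace MIAux
open ProbabilityTheory
set_option linter.unusedSectionVars false
variable {ι T : Type*} [Fintype ι] [DecidableEq ι] [MeasurableSpace T]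

/-- Resampling kernel: keep `t` with probability `1 - β`, otherwise draw from `R`. -/
noncomputable def keep (R : Measure T) (t : T) : Measure T :=
  ENNReal.ofReal (1 - (R univ).toReal) • Measure.dirac t + R

lemma keep_apply (R : Measure T) (t : T) (S : Set T) (hS : MeasurableSet S) :
    keep R t S = ENNReal.ofReal (1 - (R univ).toReal) * S.indicator 1 t + R S := by
  simp [keep, Measure.dirac_apply' _ hS]

lemma measurable_keep (R : Measure T) : Measurable (keep R) := by
  refine Measure.measurable_of_measurable_coe _ fun S hS => ?_
  simp_rw [keep_apply R _ S hS]
  exact (measurable_const.mul (measurable_one.indicator hS)).add measurable_const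

lemma isProb_keep (R : Measure T) [IsFiniteMeasure R] (hR : (R univ).toReal ≤ 1) (t : T) :
    IsProbabilityMeasure (keep R t) := by
  constructor
  rw [keep_apply R t univ MeasurableSet.univ]
  simp only [indicator_univ, Pi.one_apply, mul_one]
  conv_lhs => rw [← ENNReal.ofReal_toReal (measure_ne_top R univ)]
  rw [← ENNReal.ofReal_add (by simpa using hR) ENNReal.toReal_nonneg]
  simp

lemma measurable_piKeep (R : ι → Measure T) [∀ i, IsFiniteMeasure (R i)]
    (hR : ∀ i, (R i univ).toReal ≤ 1) :
    Measurable (fun b : ι → T => Measure.pi (fun j => keep (R j) (b j))) := by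
  have := fun j t => isProb_keep (R j) (hR j) t
  refine Measurable.measure_of_isPiSystem_of_isProbabilityMeasure generateFrom_pi.symm
    isPiSystem_pi ?_
  rintro _ ⟨S, hS, rfl⟩
  simp only [Measure.pi_pi]
  refine Finset.measurable_prod _ fun j _ => ?_
  have hSj : MeasurableSet (S j) := by simpa using hS j (mem_univ j)
  exact (Measure.measurable_coe hSj).comp ((measurable_keep (R j)).comp (measurable_pi_apply j))

noncomputable def piKeep (R : ι → Measure T) [∀ i, IsFiniteMeasure (R i)]
    (hR : ∀ i, (R i univ).toReal ≤ 1) : Kernel (ι → T) (ι → T) :=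
  ⟨fun b => Measure.pi (fun j => keep (R j) (b j)), measurable_piKeep R hR⟩

instance (R : ι → Measure T) [∀ i, IsFiniteMeasure (R i)]
    (hR : ∀ i, (R i univ).toReal ≤ 1) : IsMarkovKernel (piKeep R hR) := by
  have := fun j t => isProb_keep (R j) (hR j) t
  constructor
  intro b
  change IsProbabilityMeasure (Measure.pi (fun j => keep (R j) (b j)))
  infer_instance

lemma lintegral_keep (P Q R : Measure T) [IsProbabilityMeasure P] [IsProbabilityMeasure Q]
    [IsFiniteMeasure R]
    (g : T → ℝ) (hg : Measurable g)
    (h : P = Q.withDensity (fun t => ENNReal.ofReal (g t)) + R) (S : Set T) (hS : MeasurableSet S) :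
    ∫⁻ t, ENNReal.ofReal (g t) * keep R t S ∂Q
      = ENNReal.ofReal (1 - (R univ).toReal) * P S := by
  have hC : Q.withDensity (fun t => ENNReal.ofReal (g t)) univ
      = ENNReal.ofReal (1 - (R univ).toReal) := by
    have h1 : P univ = Q.withDensity (fun t => ENNReal.ofReal (g t)) univ + R univ := by
      conv_lhs => rw [h]
      rfl
    rw [measure_univ] at h1
    rw [ENNReal.ofReal_sub _ ENNReal.toReal_nonneg, ENNReal.ofReal_toReal (measure_ne_top _ _),
      ENNReal.ofReal_one, h1]
    exact (ENNReal.add_sub_cancel_right (measure_ne_top _ _)).symm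
  have hm : Measurable fun t => ENNReal.ofReal (g t) := hg.ennreal_ofReal
  have e : ∫⁻ t, ENNReal.ofReal (g t) * keep R t S ∂Q
      = ∫⁻ t, keep R t S ∂(Q.withDensity (fun t => ENNReal.ofReal (g t))) := by
    exact (lintegral_withDensity_eq_lintegral_mul _ hm
      ((Measure.measurable_coe hS).comp (measurable_keep R))).symm
  rw [e]
  simp_rw [keep_apply R _ S hS]
  rw [lintegral_add_right _ measurable_const, lintegral_const_mul _ (measurable_one.indicator hS),
    lintegral_indicator_one hS, lintegral_const, hC]
  conv_rhs => rw [h]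
  rw [Measure.add_apply]
  ring

lemma keep_measure_eq (D Dh R : ι → Measure T) [∀ i, IsProbabilityMeasure (D i)]
    [∀ i, IsProbabilityMeasure (Dh i)] [∀ i, IsFiniteMeasure (R i)]
    (hR : ∀ i, (R i univ).toReal ≤ 1) (g : ι → T → ℝ) (hg : ∀ i, Measurable (g i))
    (h : ∀ i, D i = (Dh i).withDensity (fun t => ENNReal.ofReal (g i t)) + R i) (i : ι) (s : T) :
    ((piKeep R hR).comap (fun b => Function.update b i s) (measurable_upd_left i s)) ∘ₘ
      ((Measure.pi Dh).withDensity (fun b => ∏ j ∈ Finset.univ.erase i, ENNReal.ofReal (g j (b j))))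
    = (∏ j ∈ Finset.univ.erase i, ENNReal.ofReal (1 - (R j univ).toReal)) •
      Measure.pi (Function.update D i (keep (R i) s)) := by
  have hp := fun j t => isProb_keep (R j) (hR j) t
  have i1 : ∀ j, IsFiniteMeasure (Function.update D i (keep (R i) s) j) := by
    intro j
    by_cases h : j = i
    · subst h; simp only [Function.update_self]; infer_instance
    · simp only [Function.update_of_ne h]; infer_instance
  have hW : Measurable fun b : ι → T => ∏ j ∈ Finset.univ.erase i, ENNReal.ofReal (g j (b j)) :=
    Finset.measurable_prod _ fun j _ => ((hg j).comp (measurable_pi_apply j)).ennreal_ofReal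
  -- both sides are the product of the following measures
  let μ : ι → Measure T := fun j => if j = i then keep (R i) s
    else ENNReal.ofReal (1 - (R j univ).toReal) • D j
  have i2 : ∀ j, IsFiniteMeasure (μ j) := by
    intro j
    by_cases h : j = i
    · simp only [μ, h, if_true]; infer_instance
    · simp only [μ, h, if_false]
      exact Measure.smul_finite _ ENNReal.ofReal_ne_top
  trans Measure.pi μ
  · symm
    refine Measure.pi_eq fun S hS => ?_
    rw [Measure.bind_apply (MeasurableSet.univ_pi hS) (Kernel.aemeasurable _),
      lintegral_withDensity_eq_lintegral_mul _ hW (Kernel.measurable_coe _ (MeasurableSet.univ_pi hS))]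
    let φ : ι → T → ENNReal := fun j t => if j = i then keep (R i) s (S i)
      else ENNReal.ofReal (g j t) * keep (R j) t (S j)
    have hφ : ∀ j, Measurable (φ j) := by
      intro j
      by_cases h : j = i
      · simp only [φ, h, if_true]; exact measurable_const
      · simp only [φ, h, if_false]
        exact (hg j).ennreal_ofReal.mul ((Measure.measurable_coe (hS j)).comp (measurable_keep (R j)))
    trans ∫⁻ b, ∏ j, φ j (b j) ∂(Measure.pi Dh)
    · refine lintegral_congr fun b => ?_
      simp only [Pi.mul_apply, Kernel.comap_apply]
      change _ * (Measure.pi (fun j => keep (R j) (Function.update b i s j))) (univ.pi S) = _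
      rw [Measure.pi_pi, ← Finset.mul_prod_erase _ _ (Finset.mem_univ i),
        ← Finset.mul_prod_erase Finset.univ (fun j => φ j (b j)) (Finset.mem_univ i)]
      simp only [φ, if_true, Function.update_self]
      rw [mul_left_comm, ← Finset.prod_mul_distrib]
      congr 1
      refine Finset.prod_congr rfl fun j hj => ?_
      have := Finset.ne_of_mem_erase hj
      simp [this]
    · rw [lintegral_pi_prod Dh φ hφ]
      refine Finset.prod_congr rfl fun j _ => ?_
      by_cases hj : j = i
      · subst hj; simp [φ, μ]
      · simp only [φ, μ, hj, if_false]
        rw [lintegral_keep (D j) (Dh j) (R j) (g j) (hg j) (h j) (S j) (hS j)]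
        simp
  · refine Measure.pi_eq fun S hS => ?_
    rw [Measure.smul_apply, Measure.pi_pi, smul_eq_mul,
      ← Finset.mul_prod_erase _ _ (Finset.mem_univ i),
      ← Finset.mul_prod_erase Finset.univ (fun j => μ j (S j)) (Finset.mem_univ i)]
    simp only [μ, if_true, Function.update_self]
    rw [mul_left_comm, ← Finset.prod_mul_distrib]
    congr 1
    refine Finset.prod_congr rfl fun j hj => ?_
    have := Finset.ne_of_mem_erase hj
    simp [this]

lemma integral_bindK {α β : Type*} [MeasurableSpace α] [MeasurableSpace β] (κ : Kernel α β)
    (μ : Measure α) (f : β → ℝ) (hf : Integrable f (κ ∘ₘ μ)) :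
    ∫ y, f y ∂(κ ∘ₘ μ) = ∫ x, ∫ y, f y ∂(κ x) ∂μ := by
  rw [Measure.comp_eq_comp_const_apply] at hf ⊢
  rw [Kernel.integral_comp hf]
  simp

/-- The resampled rule. -/
lemma keep_integral (D Dh R : ι → Measure T) [∀ i, IsProbabilityMeasure (D i)]
    [∀ i, IsProbabilityMeasure (Dh i)] [∀ i, IsFiniteMeasure (R i)]
    (hR : ∀ i, (R i univ).toReal ≤ 1) (g : ι → T → ℝ) (hg : ∀ i, Measurable (g i))
    (hg0 : ∀ i t, 0 ≤ g i t)
    (h : ∀ i, D i = (Dh i).withDensity (fun t => ENNReal.ofReal (g i t)) + R i)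
    (a : (ι → T) → ℝ) (ha : Measurable a) (c : ℝ) (hc : ∀ b, |a b| ≤ c) (i : ι) (s : T) :
    ∫ b, (∏ j ∈ Finset.univ.erase i, g j (b j)) *
        (∫ y, a y ∂(piKeep R hR (Function.update b i s))) ∂(Measure.pi Dh)
    = (∏ j ∈ Finset.univ.erase i, (1 - (R j univ).toReal)) *
      ((1 - (R i univ).toReal) * (∫ b, a (Function.update b i s) ∂(Measure.pi D)) +
        ∫ r, ∫ b, a (Function.update b i r) ∂(Measure.pi D) ∂(R i)) := by
  have hp := fun j t => isProb_keep (R j) (hR j) t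
  have hW : Measurable fun b : ι → T => ∏ j ∈ Finset.univ.erase i, ENNReal.ofReal (g j (b j)) :=
    Finset.measurable_prod _ fun j _ => ((hg j).comp (measurable_pi_apply j)).ennreal_ofReal
  have key := congrArg (fun μ => ∫ y, a y ∂μ) (keep_measure_eq D Dh R hR g hg h i s)
  have hfin : IsFiniteMeasure ((∏ j ∈ Finset.univ.erase i,
      ENNReal.ofReal (1 - (R j univ).toReal)) •
      Measure.pi (Function.update D i (keep (R i) s))) := by
    have i1 : ∀ j, IsFiniteMeasure (Function.update D i (keep (R i) s) j) := by
      intro j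
      by_cases h : j = i
      · subst h; simp only [Function.update_self]; infer_instance
      · simp only [Function.update_of_ne h]; infer_instance
    exact Measure.smul_finite _ (ENNReal.prod_ne_top fun _ _ => ENNReal.ofReal_ne_top)
  rw [integral_bindK, integral_withDensity_eq_integral_toReal_smul hW, integral_smul_measure,
    integral_upd' D i _ a ha c hc] at key
  · have hIntg : ∀ ν : Measure T, IsFiniteMeasure ν →
      Integrable (fun r => ∫ b, a (Function.update b i r) ∂(Measure.pi D)) ν := by
      intro ν _
      refine Integrable.of_bound (C := c) ?_ ?_
      · exact ((ha.comp (measurable_upd i)).stronglyMeasurable.integral_prod_right').aestronglyMeasurable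
      · refine Filter.Eventually.of_forall fun r => ?_
        have := norm_integral_le_of_norm_le_const (μ := Measure.pi D) (C := c)
          (f := fun b => a (Function.update b i r)) (Filter.Eventually.of_forall fun b => hc _)
        simpa using this
    convert key using 1
    · refine integral_congr_ae (Filter.Eventually.of_forall fun b => ?_)
      simp only [Kernel.comap_apply, smul_eq_mul, ENNReal.toReal_prod]
      congr 1
      exact Finset.prod_congr rfl fun j _ => (ENNReal.toReal_ofReal (hg0 _ _)).symm
    · rw [smul_eq_mul, ENNReal.toReal_prod]
      congr 1
      · exact Finset.prod_congr rfl fun j _ =>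
          (ENNReal.toReal_ofReal (by linarith [hR j])).symm
      · rw [keep, integral_add_measure (hIntg _ (Measure.smul_finite _ ENNReal.ofReal_ne_top))
          (hIntg _ inferInstance), integral_smul_measure, integral_dirac',
          ENNReal.toReal_ofReal (by linarith [hR i]), smul_eq_mul]
        exact ((ha.comp (measurable_upd i)).stronglyMeasurable.integral_prod_right')
  · exact Filter.Eventually.of_forall fun b => ENNReal.prod_lt_top fun _ _ => ENNReal.ofReal_lt_top
  · rw [keep_measure_eq D Dh R hR g hg h i s]
    exact Integrable.of_bound ha.aestronglyMeasurable c (Filter.Eventually.of_forall hc)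

end MIAux

open MeasureTheory Set
namespace MIAux
open ProbabilityTheory
set_option linter.unusedSectionVars false
variable {ι T : Type*} [Fintype ι] [DecidableEq ι] [MeasurableSpace T]

/-- probability that everybody except possibly `k` is accepted. -/
noncomputable def accP (g : ι → T → ℝ) (k : ι) (b : ι → T) : ℝ :=
  ∏ j ∈ Finset.univ.erase k, g j (b j)

lemma accP_upd (g : ι → T → ℝ) (k : ι) (b : ι → T) (s : T) :
    accP g k (Function.update b k s) = accP g k b := by
  unfold accP
  refine Finset.prod_congr rfl fun j hj => ?_
  rw [Function.update_of_ne (Finset.ne_of_mem_erase hj)]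

lemma measurable_accP (g : ι → T → ℝ) (hg : ∀ i, Measurable (g i)) (k : ι) :
    Measurable (accP g k) :=
  Finset.measurable_prod _ fun j _ => (hg j).comp (measurable_pi_apply j)

lemma accP_nonneg (g : ι → T → ℝ) (hg0 : ∀ i t, 0 ≤ g i t) (k : ι) (b : ι → T) :
    0 ≤ accP g k b := Finset.prod_nonneg fun j _ => hg0 _ _

lemma accP_le_one (g : ι → T → ℝ) (hg0 : ∀ i t, 0 ≤ g i t) (hg1 : ∀ i t, g i t ≤ 1) (k : ι)
    (b : ι → T) : accP g k b ≤ 1 :=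
  Finset.prod_le_one (fun j _ => hg0 _ _) (fun j _ => hg1 _ _)

lemma integral_Nk (Dh : ι → Measure T) [∀ i, IsProbabilityMeasure (Dh i)]
    (g : ι → T → ℝ) (β : ι → ℝ) (hβ : ∀ i, ∫ t, g i t ∂(Dh i) = 1 - β i)
    (i k : ι) (hik : k ≠ i) (s : T) (f : T → ℝ) (y : ℝ)
    (hf : ∫ t, (1 - g k t) * f t ∂(Dh k) = (1 - β k) * y) :
    ∫ b, (1 - g k (Function.update b i s k)) * accP g k (Function.update b i s) *
        f (Function.update b i s k) ∂(Measure.pi Dh)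
      = g i s * (∏ j ∈ Finset.univ.erase i, (1 - β j)) * y := by
  let ψ : ι → T → ℝ := fun j t =>
    if j = i then g i s else if j = k then (1 - g k t) * f t else g j t
  have e1 : ∀ b : ι → T, (1 - g k (Function.update b i s k)) * accP g k (Function.update b i s) *
        f (Function.update b i s k) = ∏ j, ψ j (b j) := by
    intro b
    rw [← Finset.mul_prod_erase Finset.univ (fun j => ψ j (b j)) (Finset.mem_univ k)]
    have : accP g k (Function.update b i s) = ∏ j ∈ Finset.univ.erase k, ψ j (b j) := by
      refine Finset.prod_congr rfl fun j hj => ?_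
      have hjk := Finset.ne_of_mem_erase hj
      by_cases hji : j = i
      · subst hji; simp [ψ]
      · simp [ψ, hji, hjk]
    rw [this]
    simp only [ψ, hik, if_false, if_true, Function.update_of_ne hik]
    ring
  simp_rw [e1]
  rw [integral_fintype_prod_eq_prod (𝕜 := ℝ) ψ,
    ← Finset.mul_prod_erase _ _ (Finset.mem_univ i)]
  have e2 : ∏ j ∈ Finset.univ.erase i, ∫ t, ψ j t ∂(Dh j)
      = ∏ j ∈ Finset.univ.erase i, ((1 - β j) * if j = k then y else 1) := by
    refine Finset.prod_congr rfl fun j hj => ?_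
    have hji := Finset.ne_of_mem_erase hj
    by_cases hjk : j = k
    · subst hjk; simp only [ψ, hji, if_false, if_true]; exact hf
    · simp only [ψ, hji, hjk, if_false, mul_one]; exact hβ j
  rw [e2, Finset.prod_mul_distrib, Finset.prod_ite_eq' , if_pos (by simp [hik])]
  simp [ψ]
  ring

lemma scalar_interim (Dh : ι → Measure T) [∀ i, IsProbabilityMeasure (Dh i)]
    (g : ι → T → ℝ) (hg : ∀ i, Measurable (g i)) (hg0 : ∀ i t, 0 ≤ g i t)
    (hg1 : ∀ i t, g i t ≤ 1)
    (β : ι → ℝ) (hβ : ∀ i, ∫ t, g i t ∂(Dh i) = 1 - β i) (he : ∑ i, β i < 1)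
    (dA : (ι → T) → ℝ) (hdA : Measurable dA) (hdAb : ∀ b, |dA b| ≤ 1)
    (da : ι → T → ℝ) (hda : ∀ i, Measurable (da i)) (hdab : ∀ i t, |da i t| ≤ 1)
    (hAa : ∀ i s, g i s ≠ 0 → ∫ b, accP g i b * dA (Function.update b i s) ∂(Measure.pi Dh)
      = (∏ j ∈ Finset.univ.erase i, (1 - β j)) * da i s)
    (α : ι → ℝ) (hα : ∀ i, α i = ∫ t, (1 - g i t) * da i t ∂(Dh i))
    (Ss : ℝ) (hS : Ss = (∑ i, α i) / (1 - ∑ i, β i)) (i : ι) (s : T) :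
    ∫ b, ((∏ j, g j (Function.update b i s j)) * dA (Function.update b i s) +
      ∑ k, (1 - g k (Function.update b i s k)) * accP g k (Function.update b i s) *
        (da k (Function.update b i s k) + (Ss - (α k + β k * Ss)))) ∂(Measure.pi Dh)
      = (∏ j ∈ Finset.univ.erase i, (1 - β j)) * (da i s + (Ss - (α i + β i * Ss))) := by
  set y : ι → ℝ := fun k => α k + β k * Ss with hy
  have hS' : Ss * (1 - ∑ i, β i) = ∑ i, α i := by
    rw [hS]; field_simp [sub_ne_zero.2 he.ne']
  have hysum : ∑ k, y k = Ss := by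
    simp only [hy, Finset.sum_add_distrib, ← Finset.sum_mul]
    linarith
  have hgi : ∀ k, Integrable (g k) (Dh k) := fun k =>
    Integrable.of_bound (hg k).aestronglyMeasurable 1 (Filter.Eventually.of_forall fun t => by
      rw [Real.norm_eq_abs, abs_of_nonneg (hg0 k t)]; exact hg1 k t)
  have hdz : ∀ k, ∫ t, (1 - g k t) * (da k t + (Ss - y k)) ∂(Dh k) = (1 - β k) * y k := by
    intro k
    have i1 : Integrable (fun t => (1 - g k t) * da k t) (Dh k) :=
      Integrable.of_bound (((measurable_const.sub (hg k)).mul (hda k)).aestronglyMeasurable) 1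
        (Filter.Eventually.of_forall fun t => by
          rw [norm_mul, Real.norm_eq_abs, Real.norm_eq_abs,
            abs_of_nonneg (by linarith [hg1 k t] : 0 ≤ 1 - g k t)]
          exact mul_le_one₀ (by linarith [hg0 k t]) (abs_nonneg _) (hdab k t))
    have i2 : Integrable (fun t => (1 - g k t) * (Ss - y k)) (Dh k) :=
      ((integrable_const _).sub (hgi k)).mul_const _
    simp_rw [mul_add]
    rw [integral_add i1 i2, ← hα k, integral_mul_const, integral_sub (integrable_const _) (hgi k),
      hβ k]
    simp only [integral_const, probReal_univ, smul_eq_mul, hy]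
    ring
  -- the bounds
  have hdzb : ∀ k t, |da k t + (Ss - y k)| ≤ 1 + |Ss - y k| := fun k t =>
    (abs_add_le _ _).trans (by linarith [hdab k t])
  have hu := measurable_upd_left (T := T) i s
  have hGm : Measurable fun b : ι → T => ∏ j, g j (Function.update b i s j) :=
    Finset.measurable_prod _ fun j _ => (hg j).comp ((measurable_pi_apply j).comp hu)
  have iG : Integrable (fun b : ι → T => (∏ j, g j (Function.update b i s j)) *
      dA (Function.update b i s)) (Measure.pi Dh) := by
    refine Integrable.of_bound (hGm.mul (hdA.comp hu)).aestronglyMeasurable 1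
      (Filter.Eventually.of_forall fun b => ?_)
    rw [norm_mul, Real.norm_eq_abs, Real.norm_eq_abs,
      abs_of_nonneg (Finset.prod_nonneg fun j _ => hg0 _ _)]
    exact mul_le_one₀ (Finset.prod_le_one (fun j _ => hg0 _ _) fun j _ => hg1 _ _)
      (abs_nonneg _) (hdAb _)
  have iN : ∀ k, Integrable (fun b : ι → T =>
      (1 - g k (Function.update b i s k)) * accP g k (Function.update b i s) *
        (da k (Function.update b i s k) + (Ss - y k))) (Measure.pi Dh) := by
    intro k
    have hk : Measurable fun b : ι → T => Function.update b i s k := (measurable_pi_apply k).comp hu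
    refine Integrable.of_bound (C := 1 + |Ss - y k|) ((((measurable_const.sub ((hg k).comp hk)).mul
      ((measurable_accP g hg k).comp hu)).mul
      (((hda k).comp hk).add measurable_const)).aestronglyMeasurable)
      (Filter.Eventually.of_forall fun b => ?_)
    have h1 := hg0 k (Function.update b i s k)
    have h2 := hg1 k (Function.update b i s k)
    have h3 := accP_nonneg g hg0 k (Function.update b i s)
    have h4 := accP_le_one g hg0 hg1 k (Function.update b i s)
    rw [norm_mul, Real.norm_eq_abs, Real.norm_eq_abs,
      abs_of_nonneg (mul_nonneg (by linarith) h3)]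
    refine (mul_le_of_le_one_left (abs_nonneg _) ?_).trans (hdzb k _)
    exact mul_le_one₀ (by linarith) h3 h4
  rw [integral_add iG (integrable_finsetSum _ fun k _ => iN k),
    integral_finsetSum _ (fun k _ => iN k)]
  set B := ∏ j ∈ Finset.univ.erase i, (1 - β j) with hB
  have t1 : ∫ b, (∏ j, g j (Function.update b i s j)) * dA (Function.update b i s) ∂(Measure.pi Dh)
      = g i s * (B * da i s) := by
    have : ∀ b : ι → T, (∏ j, g j (Function.update b i s j)) * dA (Function.update b i s)
        = g i s * (accP g i b * dA (Function.update b i s)) := by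
      intro b
      rw [← Finset.mul_prod_erase _ _ (Finset.mem_univ i), ← accP_upd g i b s,
        Function.update_self, mul_assoc]
      rfl
    simp_rw [this]
    rw [integral_const_mul]
    by_cases h0 : g i s = 0
    · simp [h0]
    · rw [hAa i s h0]
  have taccP : ∫ b, accP g i b ∂(Measure.pi Dh) = B := by
    let ψ : ι → T → ℝ := fun j t => if j = i then 1 else g j t
    have : ∀ b : ι → T, accP g i b = ∏ j, ψ j (b j) := by
      intro b
      rw [← Finset.mul_prod_erase Finset.univ (fun j => ψ j (b j)) (Finset.mem_univ i)]
      simp only [ψ, if_true, one_mul]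
      refine Finset.prod_congr rfl fun j hj => ?_
      rw [if_neg (Finset.ne_of_mem_erase hj)]
    simp_rw [this]
    rw [integral_fintype_prod_eq_prod (𝕜 := ℝ) ψ, ← Finset.mul_prod_erase _ _ (Finset.mem_univ i)]
    simp only [ψ, if_true, integral_const, probReal_univ, smul_eq_mul, one_mul]
    refine Finset.prod_congr rfl fun j hj => ?_
    rw [← hβ j]
    simp [Finset.ne_of_mem_erase hj]
  have t2 : ∫ b, (1 - g i (Function.update b i s i)) * accP g i (Function.update b i s) *
        (da i (Function.update b i s i) + (Ss - y i)) ∂(Measure.pi Dh)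
      = (1 - g i s) * B * (da i s + (Ss - y i)) := by
    simp_rw [accP_upd, Function.update_self]
    rw [integral_mul_const, integral_const_mul, taccP]
  rw [t1, ← Finset.add_sum_erase _ _ (Finset.mem_univ i), t2]
  have t3 : ∑ k ∈ Finset.univ.erase i, ∫ b,
      (1 - g k (Function.update b i s k)) * accP g k (Function.update b i s) *
        (da k (Function.update b i s k) + (Ss - y k)) ∂(Measure.pi Dh)
      = g i s * B * (Ss - y i) := by
    rw [Finset.sum_congr rfl (fun k hk => integral_Nk Dh g β hβ i k (Finset.ne_of_mem_erase hk) s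
      (fun t => da k t + (Ss - y k)) (y k) (hdz k)), ← Finset.mul_sum]
    congr 1
    rw [← hysum, ← Finset.add_sum_erase _ _ (Finset.mem_univ i)]
    ring
  rw [t3]
  ring

end MIAux

open MeasureTheory Set
namespace MIAux
open ProbabilityTheory
set_option linter.unusedSectionVars false
variable {ι T : Type*} [Fintype ι] [DecidableEq ι] [MeasurableSpace T]

lemma integral_simplex {Ω X : Type*} [MeasurableSpace Ω] [Fintype X] (μ : Measure Ω)
    [IsFiniteMeasure μ] (a : Ω → X → ℝ) (ha : ∀ x, Measurable fun b => a b x)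
    (ha0 : ∀ b x, 0 ≤ a b x) (ha1 : ∀ b, ∑ x, a b x = 1) :
    ∑ x, ∫ b, a b x ∂μ = (μ univ).toReal := by
  have hle : ∀ b x, a b x ≤ 1 := fun b x => by
    rw [← ha1 b]; exact Finset.single_le_sum (fun y _ => ha0 b y) (Finset.mem_univ x)
  rw [← integral_finsetSum]
  · simp_rw [ha1]; simp [Measure.real]
  · intro x _
    exact Integrable.of_bound (ha x).aestronglyMeasurable 1 (Filter.Eventually.of_forall fun b => by
      rw [Real.norm_eq_abs, abs_of_nonneg (ha0 b x)]; exact hle b x)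

lemma integral_g (P Q R : Measure T) [IsProbabilityMeasure P] [IsProbabilityMeasure Q]
    [IsFiniteMeasure R] (g : T → ℝ) (hg : Measurable g) (hg0 : ∀ t, 0 ≤ g t)
    (h : P = Q.withDensity (fun t => ENNReal.ofReal (g t)) + R) :
    ∫ t, g t ∂Q = 1 - (R univ).toReal := by
  have h1 : P univ = Q.withDensity (fun t => ENNReal.ofReal (g t)) univ + R univ := by
    conv_lhs => rw [h]
    rfl
  rw [measure_univ, withDensity_apply _ MeasurableSet.univ, Measure.restrict_univ] at h1
  rw [integral_eq_lintegral_of_nonneg_ae (Filter.Eventually.of_forall hg0)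
    hg.aestronglyMeasurable]
  have h2 : ∫⁻ t, ENNReal.ofReal (g t) ∂Q ≠ ⊤ := by
    intro hh; rw [hh] at h1; simp at h1
  have := congrArg ENNReal.toReal h1
  rw [ENNReal.toReal_add h2 (measure_ne_top _ _)] at this
  simp at this
  linarith

theorem alloc_transfer {X : Type*} [Fintype X] [DecidableEq X] (o : X)
    (D Dh : ι → Measure T) [∀ i, IsProbabilityMeasure (D i)] [∀ i, IsProbabilityMeasure (Dh i)]
    (ε : ℝ) (hε : Fintype.card ι * ε ≤ 1 / 2)
    (hTV : ∀ i, ∀ A : Set T, MeasurableSet A → |(D i A).toReal - (Dh i A).toReal| ≤ ε)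
    (S : ι → Set T) (hS : ∀ i, MeasurableSet (S i)) (hDS : ∀ i, D i (S i)ᶜ = 0)
    (a : (ι → T) → X → ℝ) (ha : ∀ x, Measurable fun b => a b x)
    (ha0 : ∀ b x, 0 ≤ a b x) (ha1 : ∀ b, ∑ x, a b x = 1)
    (Xt : ι → T → X → ℝ) (hXm : ∀ i x, Measurable fun t => Xt i t x)
    (hX0 : ∀ i t x, 0 ≤ Xt i t x) (hX1 : ∀ i t, ∑ x, Xt i t x = 1)
    (hX : ∀ i, ∀ s ∈ S i, ∀ x, Xt i s x = ∫ b, a (Function.update b i s) x ∂(Measure.pi D)) :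
    ∃ κ : ℝ, 1 - 2 * (Fintype.card ι * ε) ≤ κ ∧ κ ≤ 1 ∧ 0 ≤ κ ∧
      ∃ a' : (ι → T) → X → ℝ, (∀ x, Measurable fun b => a' b x) ∧ (∀ b x, 0 ≤ a' b x) ∧
        (∀ b, ∑ x, a' b x = 1) ∧ ∃ Y : ι → X → ℝ, (∀ i x, 0 ≤ Y i x) ∧
        ∀ i s x, ∫ b, a' (Function.update b i s) x ∂(Measure.pi Dh) = κ * Xt i s x + Y i x := by
  choose R g hg hg0 hg1 hgS hdec hRε using fun i => tv_decomp (D i) (Dh i) ε (hTV i) (S i) (hS i) (hDS i)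
  have hRD : ∀ i, R i ≤ D i := fun i => by
    rw [hdec i]; exact Measure.le_add_left le_rfl
  have hRfin : ∀ i, IsFiniteMeasure (R i) := fun i => isFiniteMeasure_of_le (D i) (hRD i)
  set β : ι → ℝ := fun i => (R i univ).toReal with hβdef
  have hβ0 : ∀ i, 0 ≤ β i := fun i => ENNReal.toReal_nonneg
  have hβ1 : ∀ i, β i ≤ 1 := fun i => by
    have := ENNReal.toReal_mono (measure_ne_top (D i) univ) (hRD i univ)
    simpa using this
  set e := ∑ i, β i with he
  have he0 : 0 ≤ e := Finset.sum_nonneg fun i _ => hβ0 i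
  have heε : e ≤ Fintype.card ι * ε := by
    calc e ≤ ∑ _i : ι, ε := Finset.sum_le_sum fun i _ => hRε i
      _ = _ := by simp
  have heh : e ≤ 1 / 2 := heε.trans hε
  have hβe : ∀ i, β i ≤ e := fun i => Finset.single_le_sum (fun j _ => hβ0 j) (Finset.mem_univ i)
  have hgβ : ∀ i, ∫ t, g i t ∂(Dh i) = 1 - β i := fun i =>
    integral_g (D i) (Dh i) (R i) (g i) (hg i) (hg0 i) (hdec i)
  have ha_le : ∀ b x, a b x ≤ 1 := fun b x => by
    rw [← ha1 b]; exact Finset.single_le_sum (fun y _ => ha0 b y) (Finset.mem_univ x)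
  have ha_abs : ∀ b x, |a b x| ≤ 1 := fun b x => by
    rw [abs_of_nonneg (ha0 b x)]; exact ha_le b x
  -- interim rule under D
  set h : ι → T → X → ℝ := fun i r x => ∫ b, a (Function.update b i r) x ∂(Measure.pi D) with hh
  have hhm : ∀ i x, Measurable fun r => h i r x := fun i x => by
    have : StronglyMeasurable (Function.uncurry fun (r : T) (b : ι → T) =>
        a (Function.update b i r) x) :=
      ((ha x).comp (measurable_upd i)).stronglyMeasurable
    exact this.integral_prod_right.measurable
  have hh0 : ∀ i r x, 0 ≤ h i r x := fun i r x => integral_nonneg fun b => ha0 _ _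
  have hh1 : ∀ i r, ∑ x, h i r x = 1 := fun i r => by
    have := integral_simplex (Measure.pi D) (fun b => a (Function.update b i r))
      (fun x => (ha x).comp (measurable_upd_left i r)) (fun b => ha0 _) (fun b => ha1 _)
    simpa using this
  set yb : ι → X → ℝ := fun i x => ∫ r, h i r x ∂(R i) with hyb
  have hyb0 : ∀ i x, 0 ≤ yb i x := fun i x => integral_nonneg fun r => hh0 _ _ _
  have hyb1 : ∀ i, ∑ x, yb i x = β i := fun i =>
    integral_simplex (R i) (h i) (hhm i) (hh0 i) (hh1 i)
  -- resampled ex post rule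
  set A : (ι → T) → X → ℝ := fun b x => ∫ y, a y x ∂(piKeep R hβ1 b) with hA
  have hAm : ∀ x, Measurable fun b => A b x := fun x =>
    ((ha x).stronglyMeasurable.integral_kernel (κ := piKeep R hβ1)).measurable
  have hA0 : ∀ b x, 0 ≤ A b x := fun b x => integral_nonneg fun y => ha0 _ _
  have hA1 : ∀ b, ∑ x, A b x = 1 := fun b => by
    have := integral_simplex (piKeep R hβ1 b) a ha ha0 ha1
    simpa using this
  have hA_le : ∀ b x, A b x ≤ 1 := fun b x => by
    rw [← hA1 b]; exact Finset.single_le_sum (fun y _ => hA0 b y) (Finset.mem_univ x)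
  set ai : ι → T → X → ℝ := fun i s x => (1 - β i) * Xt i s x + yb i x with hai
  have haim : ∀ i x, Measurable fun s => ai i s x := fun i x =>
    ((hXm i x).const_mul _).add_const _
  have hai0 : ∀ i s x, 0 ≤ ai i s x := fun i s x =>
    add_nonneg (mul_nonneg (by linarith [hβ1 i]) (hX0 i s x)) (hyb0 i x)
  have hai1 : ∀ i s, ∑ x, ai i s x = 1 := fun i s => by
    simp only [hai, Finset.sum_add_distrib, ← Finset.mul_sum, hX1, hyb1]; ring
  have hai_le : ∀ i s x, ai i s x ≤ 1 := fun i s x => by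
    rw [← hai1 i s]; exact Finset.single_le_sum (fun y _ => hai0 i s y) (Finset.mem_univ x)
  set δ : X → ℝ := fun x => if x = o then 1 else 0 with hδ
  have hδ0 : ∀ x, 0 ≤ δ x := fun x => by simp only [hδ]; split_ifs <;> norm_num
  have hδ1 : ∀ x, δ x ≤ 1 := fun x => by simp only [hδ]; split_ifs <;> norm_num
  have hδs : ∑ x, δ x = 1 := by simp [hδ]
  set dA : (ι → T) → X → ℝ := fun b x => (1 - e) * (A b x - δ x) with hdA
  set da : ι → T → X → ℝ := fun i s x => (1 - e) * (ai i s x - δ x) with hda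
  have hdAm : ∀ x, Measurable fun b => dA b x := fun x => ((hAm x).sub_const _).const_mul _
  have hdam : ∀ i x, Measurable fun s => da i s x := fun i x =>
    ((haim i x).sub_const _).const_mul _
  have habs1 : ∀ u w : ℝ, 0 ≤ u → u ≤ 1 → 0 ≤ w → w ≤ 1 → |(1 - e) * (u - w)| ≤ 1 := by
    intro u w h1 h2 h3 h4
    rw [abs_mul, abs_of_nonneg (by linarith : 0 ≤ 1 - e)]
    refine mul_le_one₀ (by linarith) (abs_nonneg _) (abs_le.2 ⟨by linarith, by linarith⟩)
  have hdAb : ∀ x b, |dA b x| ≤ 1 := fun x b => habs1 _ _ (hA0 b x) (hA_le b x) (hδ0 x) (hδ1 x)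
  have hdab : ∀ x i s, |da i s x| ≤ 1 := fun x i s =>
    habs1 _ _ (hai0 i s x) (hai_le i s x) (hδ0 x) (hδ1 x)
  have hdAs : ∀ b, ∑ x, dA b x = 0 := fun b => by
    simp only [hdA, ← Finset.mul_sum, Finset.sum_sub_distrib, hA1, hδs]; ring
  have hdas : ∀ i s, ∑ x, da i s x = 0 := fun i s => by
    simp only [hda, ← Finset.mul_sum, Finset.sum_sub_distrib, hai1, hδs]; ring
  have hgi : ∀ k, Integrable (g k) (Dh k) := fun k =>
    Integrable.of_bound (hg k).aestronglyMeasurable 1 (Filter.Eventually.of_forall fun t => by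
      rw [Real.norm_eq_abs, abs_of_nonneg (hg0 k t)]; exact hg1 k t)
  have ida : ∀ k x, Integrable (fun t => (1 - g k t) * da k t x) (Dh k) := fun k x =>
    Integrable.of_bound (((measurable_const.sub (hg k)).mul (hdam k x)).aestronglyMeasurable) 1
      (Filter.Eventually.of_forall fun t => by
        rw [norm_mul, Real.norm_eq_abs, Real.norm_eq_abs,
          abs_of_nonneg (by linarith [hg1 k t] : 0 ≤ 1 - g k t)]
        exact mul_le_one₀ (by linarith [hg0 k t]) (abs_nonneg _) (hdab x k t))
  set α : ι → X → ℝ := fun i x => ∫ t, (1 - g i t) * da i t x ∂(Dh i) with hα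
  have hαs : ∀ i, ∑ x, α i x = 0 := fun i => by
    simp only [hα]
    rw [← integral_finsetSum _ (fun x _ => ida i x)]
    simp_rw [← Finset.mul_sum, hdas]; simp
  have hαpos : ∀ i x, x ≠ o → 0 ≤ α i x := fun i x hx => by
    refine integral_nonneg fun t => mul_nonneg (by linarith [hg1 i t]) ?_
    simp only [hda, hδ, if_neg hx, sub_zero]
    exact mul_nonneg (by linarith) (hai0 _ _ _)
  have hαo0 : ∀ i, α i o ≤ 0 := fun i => by
    refine integral_nonpos fun t => mul_nonpos_of_nonneg_of_nonpos (by linarith [hg1 i t]) ?_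
    simp only [hda, hδ, if_true]
    exact mul_nonpos_of_nonneg_of_nonpos (by linarith) (by linarith [hai_le i t o])
  have hαo1 : ∀ i, -((1 - e) * β i) ≤ α i o := fun i => by
    have i2 : Integrable (fun t => (1 - g i t) * (-(1 - e))) (Dh i) :=
      ((integrable_const _).sub (hgi i)).mul_const _
    have : ∫ t, (1 - g i t) * (-(1 - e)) ∂(Dh i) ≤ α i o := by
      refine integral_mono i2 (ida i o) fun t => ?_
      refine mul_le_mul_of_nonneg_left ?_ (by linarith [hg1 i t])
      simp only [hda, hδ, if_true]
      nlinarith [hai0 i t o]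
    rw [integral_mul_const, integral_sub (integrable_const _) (hgi i), hgβ i] at this
    simp only [integral_const, probReal_univ, smul_eq_mul] at this
    linarith
  set Ss : X → ℝ := fun x => (∑ i, α i x) / (1 - e) with hSs
  have hSe : ∀ x, Ss x * (1 - e) = ∑ i, α i x := fun x => by
    simp only [hSs]; rw [div_mul_cancel₀]; linarith
  have hSss : ∑ x, Ss x = 0 := by
    simp only [hSs, ← Finset.sum_div]
    rw [Finset.sum_comm]; simp [hαs]
  have hSspos : ∀ x, x ≠ o → 0 ≤ Ss x := fun x hx =>
    div_nonneg (Finset.sum_nonneg fun i _ => hαpos i x hx) (by linarith)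
  -- the shift
  set c : ι → X → ℝ := fun i x => Ss x - (α i x + β i * Ss x) with hc
  have hcs : ∀ i, ∑ x, c i x = 0 := fun i => by
    simp only [hc, Finset.sum_sub_distrib, Finset.sum_add_distrib, ← Finset.mul_sum, hSss, hαs]
    ring
  have hcpos : ∀ i x, x ≠ o → 0 ≤ c i x := fun i x hx => by
    have h1 : α i x ≤ ∑ k, α k x :=
      Finset.single_le_sum (fun k _ => hαpos k x hx) (Finset.mem_univ i)
    rw [← hSe x] at h1
    have := mul_le_mul_of_nonneg_left (hβe i) (hSspos x hx)
    simp only [hc]; nlinarith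
  have hco : ∀ i, -e ≤ c i o := fun i => by
    have h1 : -((1 - e) * e) ≤ Ss o * (1 - e) := by
      rw [hSe o, he, Finset.mul_sum, ← Finset.sum_neg_distrib]
      exact Finset.sum_le_sum fun k _ => hαo1 k
    have h2 : -e ≤ Ss o := by
      by_contra hlt
      push Not at hlt
      nlinarith
    have h3 : Ss o ≤ 0 := by
      by_contra hlt
      push Not at hlt
      have : Ss o * (1 - e) ≤ 0 := by
        rw [hSe o]; exact Finset.sum_nonpos fun k _ => hαo0 k
      nlinarith
    have h4 := hαo0 i
    have h5 := hβ0 i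
    simp only [hc]; nlinarith
  set a' : (ι → T) → X → ℝ := fun b x => δ x + ((∏ j, g j (b j)) * dA b x +
      ∑ k, (1 - g k (b k)) * accP g k b * (da k (b k) x + c k x)) with ha'
  have hGm : Measurable fun b : ι → T => ∏ j, g j (b j) :=
    Finset.measurable_prod _ fun j _ => (hg j).comp (measurable_pi_apply j)
  have ha'm : ∀ x, Measurable fun b => a' b x := fun x => by
    refine measurable_const.add ((hGm.mul (hdAm x)).add (Finset.measurable_sum _ fun k _ => ?_))
    exact ((measurable_const.sub ((hg k).comp (measurable_pi_apply k))).mul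
      (measurable_accP g hg k)).mul (((hdam k x).comp (measurable_pi_apply k)).add_const _)
  have hG0 : ∀ b : ι → T, 0 ≤ ∏ j, g j (b j) := fun b => Finset.prod_nonneg fun j _ => hg0 _ _
  have hN0 : ∀ k (b : ι → T), 0 ≤ (1 - g k (b k)) * accP g k b := fun k b =>
    mul_nonneg (by linarith [hg1 k (b k)]) (accP_nonneg g hg0 k b)
  have ha'0 : ∀ b x, 0 ≤ a' b x := by
    intro b x
    by_cases hx : x = o
    · subst hx
      have h1 := atMostOne_le Finset.univ (fun j => g j (b j)) (fun j => hg0 _ _) (fun j => hg1 _ _)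
      have h2 : -(∏ j, g j (b j)) ≤ (∏ j, g j (b j)) * dA b x := by
        nlinarith [hG0 b, (abs_le.1 (hdAb x b)).1]
      have h3 : -(∑ k, (1 - g k (b k)) * accP g k b)
          ≤ ∑ k, (1 - g k (b k)) * accP g k b * (da k (b k) x + c k x) := by
        rw [← Finset.sum_neg_distrib]
        refine Finset.sum_le_sum fun k _ => ?_
        have h4 : -1 ≤ da k (b k) x + c k x := by
          have h5 := hco k
          have h6 : -(1 - e) ≤ da k (b k) x := by
            simp only [hda, hδ, if_true]; nlinarith [hai0 k (b k) x]
          linarith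
        nlinarith [hN0 k b]
      have h7 : δ x = 1 := by simp [hδ]
      simp only [ha', h7]
      simp only [accP] at h3 ⊢
      linarith
    · have h7 : δ x = 0 := by simp [hδ, hx]
      simp only [ha', h7, zero_add]
      refine add_nonneg (mul_nonneg (hG0 b) ?_) (Finset.sum_nonneg fun k _ =>
        mul_nonneg (hN0 k b) (add_nonneg ?_ (hcpos k x hx)))
      · simp only [hdA, h7, sub_zero]; exact mul_nonneg (by linarith) (hA0 _ _)
      · simp only [hda, h7, sub_zero]; exact mul_nonneg (by linarith) (hai0 _ _ _)
  have ha's : ∀ b, ∑ x, a' b x = 1 := by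
    intro b
    simp only [ha', Finset.sum_add_distrib, hδs, ← Finset.mul_sum, hdAs]
    rw [Finset.sum_comm]
    simp only [← Finset.mul_sum, Finset.sum_add_distrib, hdas, hcs]
    simp
  set B : ι → ℝ := fun i => ∏ j ∈ Finset.univ.erase i, (1 - β j) with hB
  have hB0 : ∀ i, 0 ≤ B i := fun i => Finset.prod_nonneg fun j _ => by linarith [hβ1 j]
  have hB1 : ∀ i, B i ≤ 1 := fun i =>
    Finset.prod_le_one (fun j _ => by linarith [hβ1 j]) (fun j _ => by linarith [hβ0 j])
  have hBi : ∀ i, (1 - β i) * B i = ∏ j, (1 - β j) := fun i =>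
    Finset.mul_prod_erase Finset.univ (fun j => 1 - β j) (Finset.mem_univ i)
  have hP0 : 0 ≤ ∏ j, (1 - β j) := Finset.prod_nonneg fun j _ => by linarith [hβ1 j]
  have hP1 : ∏ j, (1 - β j) ≤ 1 :=
    Finset.prod_le_one (fun j _ => by linarith [hβ1 j]) (fun j _ => by linarith [hβ0 j])
  have hPe : 1 - e ≤ ∏ j, (1 - β j) := one_sub_sum_le_prod Finset.univ β hβ0 hβ1
  refine ⟨(1 - e) * ∏ j, (1 - β j), by nlinarith, by nlinarith, mul_nonneg (by linarith) hP0,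
    a', ha'm, ha'0, ha's, fun i x => δ x + B i * ((1 - e) * (yb i x - δ x) + c i x), ?_, ?_⟩
  · intro i x
    by_cases hx : x = o
    · subst hx
      have h7 : δ x = 1 := by simp [hδ]
      simp only [h7]
      have : -1 ≤ (1 - e) * (yb i x - 1) + c i x := by nlinarith [hco i, hyb0 i x]
      nlinarith [hB0 i, hB1 i]
    · have h7 : δ x = 0 := by simp [hδ, hx]
      simp only [h7, sub_zero, zero_add]
      exact mul_nonneg (hB0 i) (add_nonneg (mul_nonneg (by linarith) (hyb0 i x)) (hcpos i x hx))
  · intro i s x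
    have hAa : ∀ i s, g i s ≠ 0 → ∫ b, accP g i b * dA (Function.update b i s) x ∂(Measure.pi Dh)
        = (∏ j ∈ Finset.univ.erase i, (1 - β j)) * da i s x := by
      intro i s hgs
      have hsS : s ∈ S i := by
        by_contra hn; exact hgs (hgS i s hn)
      have hk := keep_integral D Dh R hβ1 g hg hg0 hdec (fun b => a b x) (ha x) 1
        (fun b => ha_abs b x) i s
      have hk1 := keep_integral D Dh R hβ1 g hg hg0 hdec (fun _ => 1) measurable_const 1
        (fun b => by simp) i s
      have e1 : ∀ b : ι → T, accP g i b * dA (Function.update b i s) x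
          = (1 - e) * ((∏ j ∈ Finset.univ.erase i, g j (b j)) * A (Function.update b i s) x)
            - (1 - e) * δ x * (∏ j ∈ Finset.univ.erase i, g j (b j)) := by
        intro b; simp only [hdA, accP]; ring
      simp_rw [e1]
      have acc_int : Integrable (fun b : ι → T => ∏ j ∈ Finset.univ.erase i, g j (b j))
          (Measure.pi Dh) :=
        Integrable.of_bound (measurable_accP g hg i).aestronglyMeasurable 1
          (Filter.Eventually.of_forall fun b => by
            have h1 := accP_nonneg g hg0 i b
            have h2 := accP_le_one g hg0 hg1 i b
            simp only [accP] at h1 h2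
            rw [Real.norm_eq_abs, abs_of_nonneg h1]; exact h2)
      have acc_int2 : Integrable (fun b : ι → T => (∏ j ∈ Finset.univ.erase i, g j (b j)) *
          A (Function.update b i s) x) (Measure.pi Dh) :=
        Integrable.of_bound ((measurable_accP g hg i).mul
          ((hAm x).comp (measurable_upd_left i s))).aestronglyMeasurable 1
          (Filter.Eventually.of_forall fun b => by
            have h1 := accP_nonneg g hg0 i b
            have h2 := accP_le_one g hg0 hg1 i b
            simp only [accP] at h1 h2
            rw [Real.norm_eq_abs, abs_of_nonneg (mul_nonneg h1 (hA0 _ _))]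
            exact mul_le_one₀ h2 (hA0 _ _) (hA_le _ _))
      rw [integral_sub (acc_int2.const_mul _) (acc_int.const_mul _), integral_const_mul,
        integral_const_mul]
      simp only [integral_const, probReal_univ, smul_eq_mul, mul_one] at hk1
      have hR1 : (R i).real univ = β i := rfl
      rw [hR1] at hk1
      have hRi : (R i univ).toReal = β i := rfl
      rw [hRi] at hk hk1
      rw [hk, hk1]
      have := hX i s hsS x
      simp only [hda, hai, this, hyb, hh]
      ring
    have hs := scalar_interim Dh g hg hg0 hg1 β hgβ (by linarith) (fun b => dA b x) (hdAm x)
      (hdAb x) (fun i t => da i t x) (fun i => hdam i x) (hdab x) hAa (fun i => α i x)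
      (fun i => rfl) (Ss x) rfl i s
    have hbm : Measurable fun b => a' b x - δ x := (ha'm x).sub_const _
    have e2 : ∀ b, a' b x = δ x + (a' b x - δ x) := fun b => by ring
    have hle : ∀ b, a' b x ≤ 1 := fun b => by
      rw [← ha's b]; exact Finset.single_le_sum (fun y _ => ha'0 b y) (Finset.mem_univ x)
    have hIntg : Integrable (fun b => a' (Function.update b i s) x - δ x) (Measure.pi Dh) :=
      Integrable.of_bound (hbm.comp (measurable_upd_left i s)).aestronglyMeasurable 1
        (Filter.Eventually.of_forall fun b => by
          rw [Real.norm_eq_abs, abs_le]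
          have h1 := hle (Function.update b i s)
          have h2 := ha'0 (Function.update b i s) x
          constructor <;> linarith [hδ0 x, hδ1 x])
    have e3 : ∫ b, a' (Function.update b i s) x ∂(Measure.pi Dh)
        = δ x + ∫ b, (a' (Function.update b i s) x - δ x) ∂(Measure.pi Dh) := by
      rw [integral_sub]
      · simp
      · exact (hIntg.add (integrable_const (δ x))).congr
          (Filter.Eventually.of_forall fun b => by simp)
      · exact integrable_const _
    rw [e3]
    have e4 : ∀ b : ι → T, a' (Function.update b i s) x - δ x =
        (∏ j, g j (Function.update b i s j)) * dA (Function.update b i s) x +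
      ∑ k, (1 - g k (Function.update b i s k)) * accP g k (Function.update b i s) *
        (da k (Function.update b i s k) x + (Ss x - (α k x + β k * Ss x))) := by
      intro b; simp only [ha', hc]; ring
    simp_rw [e4]
    rw [hs, ← hBi i]
    simp only [hda, hai, hc, hB]
    ring

end MIAux

open MeasureTheory Set
namespace MIAux
open scoped RealInnerProductSpace

section Select
variable {E : Type*} [NormedAddCommGroup E] [InnerProductSpace ℝ E] [CompleteSpace E]

lemma exists_proj (K : Set E) (hK : IsClosed K) (hc : Convex ℝ K) (hne : K.Nonempty) :
    ∃ P : E → E, Continuous P ∧ (∀ u, P u ∈ K) ∧ ∀ u, ∀ w ∈ K, ⟪u - P u, w - P u⟫ ≤ 0 := by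
  have h1 : ∀ u : E, ∃ p ∈ K, ∀ w ∈ K, ⟪u - p, w - p⟫ ≤ 0 := by
    intro u
    obtain ⟨p, hp, he⟩ := exists_norm_eq_iInf_of_complete_convex hne hK.isComplete hc u
    exact ⟨p, hp, (norm_eq_iInf_iff_real_inner_le_zero hc hp).1 he⟩
  choose P hPK hP using h1
  refine ⟨P, ?_, hPK, hP⟩
  have : LipschitzWith 1 P := by
    refine LipschitzWith.of_dist_le_mul fun x y => ?_
    rw [dist_eq_norm, dist_eq_norm, NNReal.coe_one, one_mul]
    have a1 := hP x (P y) (hPK y)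
    have a2 := hP y (P x) (hPK x)
    have a3 : ‖P x - P y‖ ^ 2 ≤ ⟪x - y, P x - P y⟫ := by
      rw [← real_inner_self_eq_norm_sq]
      simp only [inner_sub_left, inner_sub_right] at a1 a2 ⊢
      rw [real_inner_comm (P x) (P y)] at *
      linarith
    have a4 := real_inner_le_norm (x - y) (P x - P y)
    rcases (norm_nonneg (P x - P y)).eq_or_lt with h | h
    · rw [← h]; exact norm_nonneg _
    · nlinarith
  exact this.continuous

lemma meas_select {T : Type*} [MeasurableSpace T] [MeasurableSpace E] [BorelSpace E]
    [SecondCountableTopology E]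
    (K : Set E) (hK : IsClosed K) (hb : Bornology.IsBounded K) (hc : Convex ℝ K)
    (hne : K.Nonempty) (c : T → E) (hcm : Measurable c) :
    ∃ z : T → E, Measurable z ∧ (∀ t, z t ∈ K) ∧ ∀ t, ∀ y ∈ K, ⟪c t, y⟫ ≤ ⟪c t, z t⟫ := by
  obtain ⟨P, hPc, hPK, hP⟩ := exists_proj K hK hc hne
  obtain ⟨B, hB⟩ := hb.exists_norm_le
  have key : ∀ c : E, ∃ p ∈ K, Filter.Tendsto (fun j : ℕ => P (((j : ℝ) + 1) • c)) Filter.atTop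
      (nhds p) ∧ ∀ y ∈ K, ⟪c, y⟫ ≤ ⟪c, p⟫ := by
    intro c
    set p : ℕ → E := fun j => P (((j : ℝ) + 1) • c) with hp
    have hpK : ∀ j, p j ∈ K := fun j => hPK _
    have hpw : ∀ j : ℕ, ∀ w ∈ K, ((j : ℝ) + 1) * ⟪c, w - p j⟫ ≤ ⟪p j, w - p j⟫ := by
      intro j w hw
      have := hP (((j : ℝ) + 1) • c) w hw
      rw [inner_sub_left, real_inner_smul_left] at this
      simp only [hp]; linarith
    have hinc : ∀ j k, j ≤ k → ‖p k - p j‖ ^ 2 ≤ ‖p k‖ ^ 2 - ‖p j‖ ^ 2 := by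
      intro j k hjk
      have a1 := hpw j (p k) (hpK k)
      have a2 := hpw k (p j) (hpK j)
      have hjk' : (j : ℝ) ≤ k := by exact_mod_cast hjk
      have hj0 : (0 : ℝ) ≤ j := Nat.cast_nonneg j
      have e1 : ⟪c, p j - p k⟫ = - ⟪c, p k - p j⟫ := by rw [← inner_neg_right, neg_sub]
      have e2 : ⟪p k, p j - p k⟫ = - ⟪p k, p k - p j⟫ := by rw [← inner_neg_right, neg_sub]
      rw [e1, e2] at a2
      have e3 : ⟪p k, p k - p j⟫ = ⟪p j, p k - p j⟫ + ‖p k - p j‖ ^ 2 := by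
        rw [← real_inner_self_eq_norm_sq, ← inner_add_left]; congr 1; abel
      have e4 : ‖p k‖ ^ 2 = ‖p j‖ ^ 2 + 2 * ⟪p j, p k - p j⟫ + ‖p k - p j‖ ^ 2 := by
        have := norm_add_sq_real (p j) (p k - p j)
        rwa [add_sub_cancel] at this
      have a3 : 0 ≤ ⟪p j, p k - p j⟫ := by
        rw [e3] at a2
        set I := ⟪c, p k - p j⟫
        set J := ⟪p j, p k - p j⟫
        set d := ‖p k - p j‖ ^ 2
        have hd : 0 ≤ d := sq_nonneg _
        by_contra hlt
        push Not at hlt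
        rcases hjk'.eq_or_lt with h | h
        · have : d = 0 := by rw [h] at a1; nlinarith
          have : p k = p j := by
            have : k = j := by exact_mod_cast h.symm
            rw [this]
          simp [J, this] at hlt
        · have h1 : ((j : ℝ) + 1) * (J + d) ≤ ((k : ℝ) + 1) * J := by
            have b1 : ((j : ℝ) + 1) * (J + d) ≤ ((j : ℝ) + 1) * (((k : ℝ) + 1) * I) :=
              mul_le_mul_of_nonneg_left (by linarith) (by linarith)
            have b2 : ((k : ℝ) + 1) * (((j : ℝ) + 1) * I) ≤ ((k : ℝ) + 1) * J :=
              mul_le_mul_of_nonneg_left a1 (by linarith)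
            linarith
          nlinarith
      linarith
    have hmono : Monotone fun j => ‖p j‖ ^ 2 := fun j k hjk => by
      have := hinc j k hjk
      have h2 := sq_nonneg ‖p k - p j‖
      simp only; linarith
    have hbd : BddAbove (range fun j => ‖p j‖ ^ 2) := by
      refine ⟨B ^ 2, ?_⟩
      rintro _ ⟨j, rfl⟩
      exact pow_le_pow_left₀ (norm_nonneg _) (hB _ (hpK j)) 2
    have hcau : CauchySeq p := by
      have hu := (tendsto_atTop_ciSup hmono hbd).cauchySeq
      rw [Metric.cauchySeq_iff'] at hu ⊢
      intro ε hε
      obtain ⟨N, hN⟩ := hu (ε ^ 2) (by positivity)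
      refine ⟨N, fun n hn => ?_⟩
      have h1 := hN n hn
      rw [Real.dist_eq] at h1
      have h2 := hinc N n hn
      rw [dist_eq_norm]
      have h3 := (abs_lt.1 h1).2
      exact lt_of_pow_lt_pow_left₀ 2 hε.le (by linarith)
    obtain ⟨q, hq⟩ := cauchySeq_tendsto_of_complete hcau
    refine ⟨q, hK.mem_of_tendsto hq (Filter.Eventually.of_forall hpK), hq, ?_⟩
    intro y hy
    have hl : Filter.Tendsto (fun j : ℕ => ⟪c, y - p j⟫) Filter.atTop (nhds ⟪c, y - q⟫) :=
      tendsto_const_nhds.inner (tendsto_const_nhds.sub hq)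
    have hr : Filter.Tendsto (fun j : ℕ => ⟪p j, y - p j⟫ * (1 / ((j : ℝ) + 1))) Filter.atTop
        (nhds (⟪q, y - q⟫ * 0)) :=
      (hq.inner (tendsto_const_nhds.sub hq)).mul tendsto_one_div_add_atTop_nhds_zero_nat
    have := le_of_tendsto_of_tendsto' hl hr fun j => by
      have h1 := hpw j y hy
      have h2 : (0 : ℝ) < (j : ℝ) + 1 := by positivity
      rw [mul_one_div, le_div_iff₀ h2]; linarith
    rw [mul_zero, inner_sub_right] at this
    linarith
  choose q hqK hq hqm using key
  refine ⟨fun t => q (c t), ?_, fun t => hqK _, fun t => hqm _⟩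
  refine measurable_of_tendsto_metrizable (f := fun (j : ℕ) t => P (((j : ℝ) + 1) • c t))
    (fun j => hPc.measurable.comp (hcm.const_smul _)) ?_
  exact tendsto_pi_nhds.2 fun t => hq (c t)

end Select
end MIAux

open MeasureTheory Set
namespace MIAux
open scoped RealInnerProductSpace

/-- vector of probabilities and a price -/
noncomputable def menuPt {X : Type*} [Fintype X] (p : X → ℝ) (r : ℝ) : EuclideanSpace ℝ (Option X) :=
  WithLp.toLp 2 (fun k => k.elim r p)

lemma inner_menuPt {X : Type*} [Fintype X] (p : X → ℝ) (r : ℝ) (y : EuclideanSpace ℝ (Option X)) :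
    ⟪menuPt p r, y⟫ = r * y none + ∑ x, p x * y (some x) := by
  simp [menuPt, PiLp.inner_apply, Fintype.sum_option, mul_comm]

lemma measurable_menuPt {X T : Type*} [Fintype X] [MeasurableSpace T] (p : T → X → ℝ) (r : T → ℝ)
    (hp : ∀ x, Measurable fun t => p t x) (hr : Measurable r) :
    Measurable fun t => menuPt (p t) (r t) := by
  refine (WithLp.measurable_toLp 2 (Option X → ℝ)).comp (measurable_pi_iff.2 fun k => ?_)
  cases k with
  | none => simpa using hr
  | some x => simpa using hp x

theorem menu_ext {X T : Type*} [Fintype X] [DecidableEq X] (o : X) [MeasurableSpace T]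
    (S : Set T) (hS : MeasurableSet S) (hne : S.Nonempty)
    (Xi : T → X → ℝ) (hXm : ∀ x, Measurable fun t => Xi t x)
    (hX0 : ∀ t x, 0 ≤ Xi t x) (hX1 : ∀ t, ∑ x, Xi t x = 1)
    (q : T → ℝ) (hq : Measurable q)
    (val : T → X → ℝ) (hval : ∀ x, Measurable fun t => val t x) (W : ℝ)
    (hv0 : ∀ t ∈ S, ∀ x, 0 ≤ val t x) (hvW : ∀ t ∈ S, ∀ x, val t x ≤ W)
    (hBIC : ∀ t ∈ S, ∀ s ∈ S, ∑ x, Xi s x * val t x - q s ≤ ∑ x, Xi t x * val t x - q t)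
    (hIR : ∀ t ∈ S, val t o ≤ ∑ x, Xi t x * val t x - q t) :
    ∃ (Xt : T → X → ℝ) (qt : T → ℝ) (a0 B : ℝ),
      (∀ x, Measurable fun t => Xt t x) ∧ (∀ t x, 0 ≤ Xt t x) ∧ (∀ t, ∑ x, Xt t x = 1) ∧
      Measurable qt ∧ (∀ t ∈ S, ∀ x, Xt t x = Xi t x) ∧ (∀ t ∈ S, qt t = q t) ∧
      (∀ t s, ∑ x, Xt s x * val t x - qt s ≤ ∑ x, Xt t x * val t x - qt t) ∧
      (∀ t, val t o ≤ ∑ x, Xt t x * val t x - qt t) ∧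
      (∀ t, a0 ≤ qt t) ∧ (∀ t, |qt t| ≤ B) ∧ (∀ t ∈ S, qt t ≤ a0 + W) := by
  classical
  have sle : ∀ t ∈ S, ∀ s, ∑ x, Xi s x * val t x ≤ W := by
    intro t ht s
    calc ∑ x, Xi s x * val t x ≤ ∑ x, Xi s x * W :=
          Finset.sum_le_sum fun x _ => mul_le_mul_of_nonneg_left (hvW t ht x) (hX0 s x)
      _ = W := by rw [← Finset.sum_mul, hX1, one_mul]
  have sge : ∀ t ∈ S, ∀ s, 0 ≤ ∑ x, Xi s x * val t x := fun t ht s =>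
    Finset.sum_nonneg fun x _ => mul_nonneg (hX0 s x) (hv0 t ht x)
  have hqW : ∀ t ∈ S, q t ≤ W := fun t ht => by
    linarith [hIR t ht, sle t ht t, hv0 t ht o]
  have hqd : ∀ t ∈ S, ∀ s ∈ S, q t ≤ q s + W := fun t ht s hs => by
    linarith [hBIC t ht s hs, sle t ht t, sge t ht s]
  obtain ⟨t0, ht0⟩ := hne
  have hW0 : 0 ≤ W := (hv0 t0 ht0 o).trans (hvW t0 ht0 o)
  obtain ⟨a0, ha0, hal, hau⟩ : ∃ a0 : ℝ, a0 ≤ 0 ∧ (∀ s ∈ S, a0 ≤ q s) ∧ ∀ s ∈ S, q s ≤ a0 + W := by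
    have hbb : BddBelow (q '' S) := ⟨q t0 - W, by
      rintro _ ⟨s, hs, rfl⟩; linarith [hqd t0 ht0 s hs]⟩
    refine ⟨min 0 (sInf (q '' S)), min_le_left _ _, fun s hs =>
      (min_le_right _ _).trans (csInf_le hbb (mem_image_of_mem _ hs)), fun s hs => ?_⟩
    rw [← sub_le_iff_le_add]
    refine le_min (by linarith [hqW s hs]) (le_csInf ⟨_, mem_image_of_mem _ ht0⟩ ?_)
    rintro _ ⟨s', hs', rfl⟩
    linarith [hqd s hs s' hs']
  set B := |a0| + W + 1 with hB
  have hab := neg_abs_le a0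
  have hab2 := le_abs_self a0
  set Z : T → EuclideanSpace ℝ (Option X) := fun t => menuPt (Xi t) (q t) with hZ
  have hZm : Measurable Z := measurable_menuPt Xi q hXm hq
  set z0 : EuclideanSpace ℝ (Option X) := menuPt (fun x => if x = o then 1 else 0) 0 with hz0
  set K := closure (convexHull ℝ (Z '' S ∪ {z0})) with hK
  set c : T → EuclideanSpace ℝ (Option X) := fun t => menuPt (val t) (-1) with hc
  have hcm : Measurable c := measurable_menuPt val _ hval measurable_const
  have hcin : ∀ t y, ⟪c t, y⟫ = ∑ x, y (some x) * val t x - y none := fun t y => by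
    rw [hc]; simp only; rw [inner_menuPt]; simp only [mul_comm (val t _)]; ring
  have hsub : Z '' S ∪ {z0} ⊆ K := (subset_convexHull ℝ _).trans subset_closure
  have hKc : Convex ℝ K := (convex_convexHull ℝ _).closure
  -- K is contained in a box
  set Q : Set (EuclideanSpace ℝ (Option X)) :=
    {y | (∀ x, 0 ≤ y (some x)) ∧ ∑ x, y (some x) = 1 ∧ a0 ≤ y none ∧ y none ≤ B} with hQ
  have hcoord : ∀ k, Continuous fun y : EuclideanSpace ℝ (Option X) => y k := fun k => by fun_prop
  have hQcl : IsClosed Q := by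
    refine IsClosed.and ?_ (IsClosed.and ?_ (IsClosed.and ?_ ?_))
    · simp only [ofPred_forall]
      exact isClosed_iInter fun x => isClosed_le continuous_const (hcoord _)
    · exact isClosed_eq (continuous_finsetSum _ fun x _ => hcoord _) continuous_const
    · exact isClosed_le continuous_const (hcoord _)
    · exact isClosed_le (hcoord _) continuous_const
  have hQc : Convex ℝ Q := by
    rintro y ⟨h1, h2, h3, h4⟩ y' ⟨h1', h2', h3', h4'⟩ u w hu hw huw
    refine ⟨fun x => ?_, ?_, ?_, ?_⟩
    · simp only [PiLp.add_apply, PiLp.smul_apply, smul_eq_mul]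
      exact add_nonneg (mul_nonneg hu (h1 x)) (mul_nonneg hw (h1' x))
    · simp only [PiLp.add_apply, PiLp.smul_apply, smul_eq_mul, Finset.sum_add_distrib,
        ← Finset.mul_sum, h2, h2']
      linarith
    · simp only [PiLp.add_apply, PiLp.smul_apply, smul_eq_mul]
      nlinarith
    · simp only [PiLp.add_apply, PiLp.smul_apply, smul_eq_mul]
      nlinarith
  have hKQ : K ⊆ Q := by
    refine closure_minimal (convexHull_min ?_ hQc) hQcl
    rintro y (⟨s, hs, rfl⟩ | hy)
    · refine ⟨fun x => ?_, ?_, ?_, ?_⟩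
      · simpa [hZ, menuPt] using hX0 s x
      · simpa [hZ, menuPt] using hX1 s
      · simpa [hZ, menuPt] using hal s hs
      · have := hau s hs
        have : q s ≤ B := by linarith
        simpa [hZ, menuPt] using this
    · rw [mem_singleton_iff] at hy
      subst hy
      refine ⟨fun x => ?_, ?_, ?_, ?_⟩
      · simp only [hz0, menuPt, Option.elim]; split_ifs <;> norm_num
      · simp [hz0, menuPt]
      · simpa [hz0, menuPt] using ha0
      · have : 0 ≤ B := by positivity
        simpa [hz0, menuPt] using this
  have hQb : Bornology.IsBounded Q := by
    refine isBounded_iff_forall_norm_le.2 ⟨√(∑ _k : Option X, B ^ 2), ?_⟩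
    rintro y ⟨h1, h2, h3, h4⟩
    rw [EuclideanSpace.norm_eq]
    refine Real.sqrt_le_sqrt (Finset.sum_le_sum fun k _ => ?_)
    rw [Real.norm_eq_abs, sq_abs]
    refine sq_le_sq' ?_ ?_
    · cases k with
      | none => linarith
      | some x => linarith [h1 x, abs_nonneg a0]
    · cases k with
      | none => linarith
      | some x =>
        have : y (some x) ≤ 1 := by
          rw [← h2]; exact Finset.single_le_sum (fun z _ => h1 z) (Finset.mem_univ x)
        linarith [abs_nonneg a0]
  obtain ⟨zs, hzsm, hzsK, hzsmax⟩ := meas_select K isClosed_closure (hQb.subset hKQ) hKc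
    ⟨z0, hsub (Or.inr rfl)⟩ c hcm
  have hZmax : ∀ t ∈ S, ∀ y ∈ K, ⟪c t, y⟫ ≤ ⟪c t, Z t⟫ := by
    intro t ht
    have hcl : IsClosed {y | ⟪c t, y⟫ ≤ ⟪c t, Z t⟫} :=
      isClosed_le (continuous_const.inner continuous_id) continuous_const
    have hcv : Convex ℝ {y | ⟪c t, y⟫ ≤ ⟪c t, Z t⟫} := by
      intro y hy y' hy' u w hu hw huw
      change ⟪c t, y⟫ ≤ ⟪c t, Z t⟫ at hy
      change ⟪c t, y'⟫ ≤ ⟪c t, Z t⟫ at hy'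
      change ⟪c t, u • y + w • y'⟫ ≤ ⟪c t, Z t⟫
      rw [inner_add_right, real_inner_smul_right, real_inner_smul_right]
      have h1 := mul_le_mul_of_nonneg_left hy hu
      have h2 := mul_le_mul_of_nonneg_left hy' hw
      have h3 : u * ⟪c t, Z t⟫ + w * ⟪c t, Z t⟫ = ⟪c t, Z t⟫ := by rw [← add_mul, huw, one_mul]
      linarith
    refine closure_minimal (convexHull_min ?_ hcv) hcl
    have e : ⟪c t, Z t⟫ = ∑ x, Xi t x * val t x - q t := by
      rw [hcin]; simp [hZ, menuPt]
    rintro y (⟨s, hs, rfl⟩ | hy)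
    · change ⟪c t, Z s⟫ ≤ ⟪c t, Z t⟫
      rw [e, hcin]
      simpa [hZ, menuPt] using hBIC t ht s hs
    · rw [mem_singleton_iff] at hy
      subst hy
      change ⟪c t, z0⟫ ≤ ⟪c t, Z t⟫
      rw [e, hcin]
      simpa [hz0, menuPt] using hIR t ht
  set zt : T → EuclideanSpace ℝ (Option X) := S.piecewise Z zs with hzt
  have hztm : Measurable zt := Measurable.piecewise hS hZm hzsm
  have hztS : ∀ t ∈ S, zt t = Z t := fun t ht => Set.piecewise_eq_of_mem _ _ _ ht
  have hztN : ∀ t ∉ S, zt t = zs t := fun t ht => Set.piecewise_eq_of_notMem _ _ _ ht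
  have hztK : ∀ t, zt t ∈ K := fun t => by
    by_cases ht : t ∈ S
    · rw [hztS t ht]; exact hsub (Or.inl (mem_image_of_mem _ ht))
    · rw [hztN t ht]; exact hzsK t
  have hztmax : ∀ t, ∀ y ∈ K, ⟪c t, y⟫ ≤ ⟪c t, zt t⟫ := fun t => by
    by_cases ht : t ∈ S
    · rw [hztS t ht]; exact hZmax t ht
    · rw [hztN t ht]; exact hzsmax t
  have hcm' : ∀ k, Measurable fun t => zt t k := fun k => (hcoord k).measurable.comp hztm
  refine ⟨fun t x => zt t (some x), fun t => zt t none, a0, B, fun x => hcm' _,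
    fun t x => (hKQ (hztK t)).1 x, fun t => (hKQ (hztK t)).2.1, hcm' _, ?_, ?_, ?_, ?_,
    fun t => (hKQ (hztK t)).2.2.1, ?_, ?_⟩
  · intro t ht x
    simp only [hztS t ht]; simp [hZ, menuPt]
  · intro t ht
    simp only [hztS t ht]; simp [hZ, menuPt]
  · intro t s
    have := hztmax t _ (hztK s)
    simpa only [hcin] using this
  · intro t
    have := hztmax t z0 (hsub (Or.inr rfl))
    simp only [hcin] at this
    simpa [hz0, menuPt] using this
  · intro t
    have h1 := (hKQ (hztK t)).2.2.1
    have h2 := (hKQ (hztK t)).2.2.2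
    exact abs_le.2 ⟨by linarith, h2⟩
  · intro t ht
    have : zt t none = q t := by rw [hztS t ht]; simp [hZ, menuPt]
    simp only [this]
    exact hau t ht

/-- Price transfer. -/
lemma price_transfer {T : Type*} [MeasurableSpace T] (P Q : Measure T) [IsProbabilityMeasure P]
    [IsProbabilityMeasure Q] (ε : ℝ)
    (h : ∀ A : Set T, MeasurableSet A → |(P A).toReal - (Q A).toReal| ≤ ε)
    (S : Set T) (hPS : P Sᶜ = 0) (q : T → ℝ) (hq : Measurable q)
    (a0 B W : ℝ) (hW : 0 ≤ W) (ha : ∀ t, a0 ≤ q t) (hB : ∀ t, |q t| ≤ B) (hS : ∀ t ∈ S, q t ≤ a0 + W) :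
    ∫ t, q t ∂P - W * ε ≤ ∫ t, q t ∂Q := by
  obtain ⟨R, g, hg, hg0, hg1, -, hdec, hR⟩ := tv_decomp P Q ε h univ MeasurableSet.univ (by simp)
  have hRP : R ≤ P := by rw [hdec]; exact Measure.le_add_left le_rfl
  have hRfin : IsFiniteMeasure R := isFiniteMeasure_of_le P hRP
  have hqint : ∀ μ : Measure T, IsFiniteMeasure μ → Integrable q μ := fun μ _ =>
    Integrable.of_bound hq.aestronglyMeasurable B (Filter.Eventually.of_forall hB)
  set f : T → ℝ := fun t => q t - a0 with hf
  have hfint : ∀ μ : Measure T, IsFiniteMeasure μ → Integrable f μ := fun μ hμ =>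
    (hqint μ hμ).sub (integrable_const _)
  have hCfin : IsFiniteMeasure (Q.withDensity (fun t => ENNReal.ofReal (g t))) :=
    isFiniteMeasure_of_le P (by conv_rhs => rw [hdec]
                                exact Measure.le_add_right le_rfl)
  have e1 : ∫ t, f t ∂P = ∫ t, g t * f t ∂Q + ∫ t, f t ∂(R) := by
    conv_lhs => rw [hdec]
    rw [integral_add_measure (hfint _ hCfin) (hfint _ hRfin),
      integral_withDensity_eq_integral_toReal_smul (hg.ennreal_ofReal)
      (Filter.Eventually.of_forall fun _ => ENNReal.ofReal_lt_top)]
    simp [ENNReal.toReal_ofReal (hg0 _)]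
  have e2 : ∫ t, g t * f t ∂Q ≤ ∫ t, f t ∂Q := by
    refine integral_mono_of_nonneg (Filter.Eventually.of_forall fun t =>
      mul_nonneg (hg0 t) (by simp only [hf]; linarith [ha t])) (hfint Q inferInstance)
      (Filter.Eventually.of_forall fun t => ?_)
    exact mul_le_of_le_one_left (by simp only [hf]; linarith [ha t]) (hg1 t)
  have hRS : ∀ᵐ t ∂(R), f t ≤ W := by
    have : ∀ᵐ t ∂P, t ∈ S := by rw [ae_iff]; exact hPS
    have := (Measure.absolutelyContinuous_of_le hRP).ae_le this
    filter_upwards [this] with t ht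
    simp only [hf]; linarith [hS t ht]
  have e3 : ∫ t, f t ∂(R) ≤ W * ε := by
    calc ∫ t, f t ∂(R) ≤ ∫ _t, W ∂(R) := integral_mono_ae (hfint R hRfin) (integrable_const _) hRS
      _ = (R univ).toReal * W := by simp [Measure.real]
      _ ≤ W * ε := by nlinarith
  have e4 : ∫ t, f t ∂P = ∫ t, q t ∂P - a0 := by
    simp only [hf]; rw [integral_sub (hqint P inferInstance) (integrable_const _)]; simp
  have e5 : ∫ t, f t ∂Q = ∫ t, q t ∂Q - a0 := by
    simp only [hf]; rw [integral_sub (hqint Q inferInstance) (integrable_const _)]; simp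
  linarith

end MIAux

open MeasureTheory Set
open MultiItem
namespace MIAux

lemma measurable_optSome {α : Type*} [MeasurableSpace α] : Measurable (some : α → Option α) :=
  fun _ hs => hs

lemma measurable_of_some {α β : Type*} [MeasurableSpace α] [MeasurableSpace β] {f : Option α → β}
    (hf : Measurable fun a => f (some a)) : Measurable f :=
  fun _ hs => hf hs

lemma measurableSet_none {α : Type*} [MeasurableSpace α] : MeasurableSet ({none} : Set (Option α)) := by
  change MeasurableSet (some ⁻¹' ({none} : Set (Option α)))
  have : some ⁻¹' ({none} : Set (Option α)) = ∅ := by ext; simp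
  rw [this]; exact MeasurableSet.empty

lemma measurable_allSome {n : ℕ} {α : Type*} [MeasurableSpace α] :
    Measurable fun (b : Fin n → α) (j : Fin n) => (some (b j) : Option α) :=
  measurable_pi_iff.2 fun j => measurable_optSome.comp (measurable_pi_apply j)

variable {n m : ℕ}

open Classical in
/-- Mechanism built from a direct rule. -/
noncomputable def mkMech (a : (Fin n → Fin m → ℝ) → Alloc n m → ℝ)
    (p : (Fin n → Fin m → ℝ) → Fin n → ℝ) (ha : ∀ x, Measurable fun b => a b x)
    (ha0 : ∀ b x, 0 ≤ a b x) (ha1 : ∀ b, ∑ x, a b x = 1) (hp : ∀ i, Measurable fun b => p b i) :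
    Mechanism n m where
  allocProb b x := if ∃ i, b i = none then (if x = emptyAlloc n m then 1 else 0)
    else a (fun j => (b j).getD 0) x
  pay b i := if ∃ i, b i = none then 0 else p (fun j => (b j).getD 0) i
  allocProb_nonneg b x := by
    split_ifs
    · exact zero_le_one
    · exact le_rfl
    · exact ha0 _ _
  allocProb_sum_one b := by
    by_cases h : ∃ i, b i = none
    · simp [h]
    · simp only [h, if_false]; exact ha1 _
  optOut b hb := by
    constructor
    · funext x; simp only [hb, if_true]
    · funext i; simp only [hb, if_true]
  meas_allocProb x := by
    have hg : Measurable fun (b : Fin n → Option (Fin m → ℝ)) (j : Fin n) => (b j).getD 0 :=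
      measurable_pi_iff.2 fun j =>
        (measurable_of_some (f := fun o : Option (Fin m → ℝ) => o.getD 0) measurable_id).comp
          (measurable_pi_apply j)
    refine Measurable.ite ?_ measurable_const ((ha x).comp hg)
    have : {b : Fin n → Option (Fin m → ℝ) | ∃ i, b i = none} =
        ⋃ i, (fun b => b i) ⁻¹' {none} := by ext b; simp
    rw [this]
    exact MeasurableSet.iUnion fun i => measurable_pi_apply i measurableSet_none
  meas_pay i := by
    have hg : Measurable fun (b : Fin n → Option (Fin m → ℝ)) (j : Fin n) => (b j).getD 0 :=
      measurable_pi_iff.2 fun j =>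
        (measurable_of_some (f := fun o : Option (Fin m → ℝ) => o.getD 0) measurable_id).comp
          (measurable_pi_apply j)
    refine Measurable.ite ?_ measurable_const ((hp i).comp hg)
    have : {b : Fin n → Option (Fin m → ℝ) | ∃ i, b i = none} =
        ⋃ i, (fun b => b i) ⁻¹' {none} := by ext b; simp
    rw [this]
    exact MeasurableSet.iUnion fun i => measurable_pi_apply i measurableSet_none

lemma mkMech_alloc (a : (Fin n → Fin m → ℝ) → Alloc n m → ℝ)
    (p : (Fin n → Fin m → ℝ) → Fin n → ℝ) (ha ha0 ha1 hp) (b : Fin n → Fin m → ℝ) :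
    (mkMech a p ha ha0 ha1 hp).allocProb (fun j => some (b j)) = a b := by
  funext x; simp [mkMech]

lemma mkMech_pay (a : (Fin n → Fin m → ℝ) → Alloc n m → ℝ)
    (p : (Fin n → Fin m → ℝ) → Fin n → ℝ) (ha ha0 ha1 hp) (b : Fin n → Fin m → ℝ) :
    (mkMech a p ha ha0 ha1 hp).pay (fun j => some (b j)) = p b := by
  funext x; simp [mkMech]

lemma interim_some (v : Fin n → (Fin m → ℝ) → Alloc n m → ℝ) (M : Mechanism n m)
    (D : Fin n → Measure (Fin m → ℝ)) (i : Fin n) (t s : Fin m → ℝ) :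
    interim v M D i t (some s) =
      ∫ b, util v M i t (fun j => some (Function.update b i s j)) ∂(Measure.pi D) := by
  unfold interim
  congr 1; funext b; congr 1; funext j
  by_cases h : j = i
  · subst h; simp
  · simp [h]

lemma interim_none (v : Fin n → (Fin m → ℝ) → Alloc n m → ℝ) (M : Mechanism n m)
    (D : Fin n → Measure (Fin m → ℝ)) [∀ i, IsProbabilityMeasure (D i)] (i : Fin n)
    (t : Fin m → ℝ) :
    interim v M D i t none = v i t (emptyAlloc n m) := by
  unfold interim
  have : ∀ b : Fin n → Fin m → ℝ, util v M i t (fun j => if j = i then none else some (b j))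
      = v i t (emptyAlloc n m) := by
    intro b
    have h := M.optOut (fun j => if j = i then none else some (b j)) ⟨i, by simp⟩
    unfold util
    rw [h.1, h.2]; simp
  simp_rw [this]; simp

/-- the box -/
def box (m : ℕ) (H : ℝ) : Set (Fin m → ℝ) := {t | ∀ j, t j ∈ Icc (0:ℝ) H}

lemma isClosed_box (H : ℝ) : IsClosed (box m H) := by
  have : box m H = Set.pi univ fun _ => Icc (0:ℝ) H := by
    ext t; exact ⟨fun h j _ => h j, fun h j => h j (mem_univ j)⟩
  rw [this]; exact isClosed_set_pi fun _ _ => isClosed_Icc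

lemma box_compl (H : ℝ) (μ : Measure (Fin m → ℝ)) [IsProbabilityMeasure μ] (h : suppBox H μ) :
    μ (box m H)ᶜ = 0 := (prob_compl_eq_zero_iff (isClosed_box H).measurableSet).2 h

lemma box_ae (H : ℝ) (μ : Measure (Fin m → ℝ)) [IsProbabilityMeasure μ] (h : suppBox H μ) :
    ∀ᵐ t ∂μ, t ∈ box m H := by rw [ae_iff]; exact box_compl H μ h

lemma box_ae_pi (H : ℝ) (D : Fin n → Measure (Fin m → ℝ)) [∀ i, IsProbabilityMeasure (D i)]
    (h : ∀ i, suppBox H (D i)) : ∀ᵐ b ∂(Measure.pi D), ∀ i, b i ∈ box m H := by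
  rw [ae_all_iff]
  intro i
  exact (Measure.quasiMeasurePreserving_eval D i).ae (box_ae H (D i) (h i))

lemma msupport_sub_box (H : ℝ) (μ : Measure (Fin m → ℝ)) [IsProbabilityMeasure μ]
    (h : suppBox H μ) : msupport μ ⊆ box m H := by
  intro t ht
  by_contra hn
  have := ht (box m H)ᶜ (isClosed_box H).isOpen_compl hn
  rw [box_compl H μ h] at this
  exact lt_irrefl _ this

lemma msupport_eq (μ : Measure (Fin m → ℝ)) : msupport μ = μ.support := by
  rw [Measure.support_eq_forall_isOpen]
  ext t
  exact ⟨fun h U h1 h2 => h U h2 h1, fun h U h1 h2 => h U h2 h1⟩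

lemma val_measurable (L : ℝ) (f : (Fin m → ℝ) → ℝ)
    (h : ∀ t t', |f t - f t'| ≤ L * ∑ j, |t j - t' j|) : Measurable f := by
  refine Continuous.measurable (continuous_iff_continuousAt.2 fun t => ?_)
  rw [ContinuousAt, tendsto_iff_dist_tendsto_zero]
  have h1 : Filter.Tendsto (fun s : Fin m → ℝ => L * ∑ j, |s j - t j|) (nhds t)
      (nhds (L * ∑ j, |t j - t j|)) := by
    have : Continuous fun s : Fin m → ℝ => L * ∑ j, |s j - t j| := by fun_prop
    exact this.tendsto t
  simp only [sub_self, abs_zero, Finset.sum_const_zero, mul_zero] at h1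
  exact squeeze_zero (fun _ => dist_nonneg) (fun s => by rw [Real.dist_eq]; exact h s t) h1

lemma simplex_sum_le {X : Type*} [Fintype X] (p f : X → ℝ) (W : ℝ) (hp : ∀ x, 0 ≤ p x)
    (hs : ∑ x, p x = 1) (hf : ∀ x, f x ≤ W) : ∑ x, p x * f x ≤ W := by
  calc ∑ x, p x * f x ≤ ∑ x, p x * W :=
        Finset.sum_le_sum fun x _ => mul_le_mul_of_nonneg_left (hf x) (hp x)
    _ = W := by rw [← Finset.sum_mul, hs, one_mul]

lemma pay_le (H W : ℝ) (v : Fin n → (Fin m → ℝ) → Alloc n m → ℝ)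
    (hvW : ∀ i, ∀ t ∈ box m H, ∀ x, v i t x ≤ W) (M : Mechanism n m) (hIR : IsIR H v M)
    (b : Fin n → Fin m → ℝ) (hb : ∀ i, b i ∈ box m H) (i : Fin n) :
    M.pay (fun j => some (b j)) i ≤ W := by
  have h1 := hIR b hb i
  unfold util at h1
  have := simplex_sum_le (M.allocProb fun j => some (b j)) (v i (b i)) W (M.allocProb_nonneg _)
    (M.allocProb_sum_one _) (hvW i (b i) (hb i))
  linarith

lemma rev_le (H W : ℝ) (hW : 0 ≤ W) (v : Fin n → (Fin m → ℝ) → Alloc n m → ℝ)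
    (hvW : ∀ i, ∀ t ∈ box m H, ∀ x, v i t x ≤ W) (M : Mechanism n m) (hIR : IsIR H v M)
    (D : Fin n → Measure (Fin m → ℝ)) [∀ i, IsProbabilityMeasure (D i)]
    (hD : ∀ i, suppBox H (D i)) : RevT M D ≤ n * W := by
  unfold RevT
  by_cases hIntg : Integrable (fun b => ∑ i, M.pay (fun j => some (b j)) i) (Measure.pi D)
  · have : ∫ b, (∑ i, M.pay (fun j => some (b j)) i) ∂(Measure.pi D)
        ≤ ∫ _b, (n * W : ℝ) ∂(Measure.pi D) := by
      refine integral_mono_ae hIntg (integrable_const _) ?_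
      filter_upwards [box_ae_pi H D hD] with b hb
      calc ∑ i, M.pay (fun j => some (b j)) i ≤ ∑ _i : Fin n, W :=
            Finset.sum_le_sum fun i _ => pay_le H W v hvW M hIR b hb i
        _ = n * W := by simp
    simpa using this
  · rw [integral_undef hIntg]; positivity

/-- The trivial mechanism. -/
lemma zero_mech (H : ℝ) (v : Fin n → (Fin m → ℝ) → Alloc n m → ℝ)
    (hv0 : ∀ i, ∀ t ∈ box m H, ∀ x, 0 ≤ v i t x)
    (D : Fin n → Measure (Fin m → ℝ)) [∀ i, IsProbabilityMeasure (D i)] :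
    ∃ M : Mechanism n m, IsIR H v M ∧ IsBIC 0 H v M D ∧ RevT M D = 0 := by
  refine ⟨mkMech (fun _ x => if x = emptyAlloc n m then 1 else 0) (fun _ _ => 0)
    (fun _ => measurable_const) (fun _ x => by split_ifs <;> norm_num) (fun _ => by simp)
    (fun _ => measurable_const), ?_, ?_, ?_⟩
  · intro t ht i
    unfold util
    rw [mkMech_alloc, mkMech_pay]
    simpa using hv0 i (t i) (ht i) _
  · intro i t _ bid _
    have hs : ∀ s, interim v (mkMech (fun _ x => if x = emptyAlloc n m then 1 else 0) (fun _ _ => 0)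
        (fun _ => measurable_const) (fun _ x => by split_ifs <;> norm_num) (fun _ => by simp)
        (fun _ => measurable_const)) D i t (some s) = v i t (emptyAlloc n m) := by
      intro s
      rw [interim_some]
      unfold util
      simp_rw [mkMech_alloc, mkMech_pay]
      simp
    rw [hs t]
    cases bid with
    | none => rw [interim_none]; simp
    | some s => rw [hs s]; simp
  · unfold RevT
    simp_rw [mkMech_pay]
    simp

end MIAux

open MeasureTheory Set
open MultiItem
namespace MIAux
variable {n m : ℕ}

/-- Building the mechanism for the new distribution. -/
lemma new_mech (H W : ℝ) (hW : 0 ≤ W) (v : Fin n → (Fin m → ℝ) → Alloc n m → ℝ)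
    (hvm : ∀ i x, Measurable fun t => v i t x)
    (hv0 : ∀ i, ∀ t ∈ box m H, ∀ x, 0 ≤ v i t x) (hvW : ∀ i, ∀ t ∈ box m H, ∀ x, v i t x ≤ W)
    (Dh : Fin n → Measure (Fin m → ℝ)) [∀ i, IsProbabilityMeasure (Dh i)]
    (hDh : ∀ i, suppBox H (Dh i))
    (κ : ℝ) (hκ0 : 0 ≤ κ) (hκ1 : κ ≤ 1)
    (a' : (Fin n → Fin m → ℝ) → Alloc n m → ℝ) (ha : ∀ x, Measurable fun b => a' b x)
    (ha0 : ∀ b x, 0 ≤ a' b x) (ha1 : ∀ b, ∑ x, a' b x = 1)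
    (Y : Fin n → Alloc n m → ℝ) (hY : ∀ i x, 0 ≤ Y i x)
    (Xt : Fin n → (Fin m → ℝ) → Alloc n m → ℝ) (hXm : ∀ i x, Measurable fun t => Xt i t x)
    (hX0 : ∀ i t x, 0 ≤ Xt i t x) (hX1 : ∀ i t, ∑ x, Xt i t x = 1)
    (qt : Fin n → (Fin m → ℝ) → ℝ) (hqm : ∀ i, Measurable (qt i))
    (B : Fin n → ℝ) (hqB : ∀ i t, |qt i t| ≤ B i)
    (hIntg : ∀ i s x, ∫ b, a' (Function.update b i s) x ∂(Measure.pi Dh) = κ * Xt i s x + Y i x)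
    (hBIC : ∀ i t s, ∑ x, Xt i s x * v i t x - qt i s ≤ ∑ x, Xt i t x * v i t x - qt i t)
    (hIR : ∀ i t, v i t (emptyAlloc n m) ≤ ∑ x, Xt i t x * v i t x - qt i t) :
    ∃ M : Mechanism n m, IsIR H v M ∧ IsBIC 0 H v M Dh ∧
      RevT M Dh = ∑ i, ∫ t, (κ * qt i t - (1 - κ) * W) ∂(Dh i) := by
  set U : Fin n → (Fin m → ℝ) → ℝ := fun i t =>
    ∑ x, (κ * Xt i t x + Y i x) * v i t x - κ * qt i t + (1 - κ) * W with hU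
  have hUm : ∀ i, Measurable (U i) := fun i =>
    ((Finset.measurable_sum _ fun x _ => (((hXm i x).const_mul κ).add_const _).mul (hvm i x)).sub
      ((hqm i).const_mul κ)).add_const _
  have hsplit : ∀ i s t, ∑ x, (κ * Xt i s x + Y i x) * v i t x
      = κ * ∑ x, Xt i s x * v i t x + ∑ x, Y i x * v i t x := by
    intro i s t
    rw [Finset.mul_sum, ← Finset.sum_add_distrib]
    exact Finset.sum_congr rfl fun x _ => by ring
  have hYv : ∀ i, ∀ t ∈ box m H, 0 ≤ ∑ x, Y i x * v i t x := fun i t ht =>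
    Finset.sum_nonneg fun x _ => mul_nonneg (hY i x) (hv0 i t ht x)
  have hUo : ∀ i, ∀ t ∈ box m H, v i t (emptyAlloc n m) ≤ U i t := by
    intro i t ht
    simp only [hU]; rw [hsplit]
    nlinarith [mul_le_mul_of_nonneg_left (hIR i t) hκ0, hYv i t ht,
      hvW i t ht (emptyAlloc n m)]
  set p : (Fin n → Fin m → ℝ) → Fin n → ℝ := fun b i => ∑ x, a' b x * v i (b i) x - U i (b i) with hp
  have hpm : ∀ i, Measurable fun b => p b i := fun i =>
    (Finset.measurable_sum _ fun x _ => (ha x).mul ((hvm i x).comp (measurable_pi_apply i))).sub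
      ((hUm i).comp (measurable_pi_apply i))
  have hale : ∀ b x, a' b x ≤ 1 := fun b x => by
    rw [← ha1 b]; exact Finset.single_le_sum (fun y _ => ha0 b y) (Finset.mem_univ x)
  have hXle : ∀ i b x, Xt i b x ≤ 1 := fun i b x => by
    rw [← hX1 i b]; exact Finset.single_le_sum (fun y _ => hX0 i b y) (Finset.mem_univ x)
  have haint : ∀ i s x, Integrable (fun b => a' (Function.update b i s) x) (Measure.pi Dh) :=
    fun i s x => Integrable.of_bound ((ha x).comp (measurable_upd_left i s)).aestronglyMeasurable 1
      (Filter.Eventually.of_forall fun b => by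
        rw [Real.norm_eq_abs, abs_of_nonneg (ha0 _ x)]; exact hale _ x)
  have hsum : ∀ i s t, ∫ b, ∑ x, a' (Function.update b i s) x * v i t x ∂(Measure.pi Dh)
      = ∑ x, (κ * Xt i s x + Y i x) * v i t x := by
    intro i s t
    rw [integral_finsetSum _ fun x _ => (haint i s x).mul_const _]
    exact Finset.sum_congr rfl fun x _ => by rw [integral_mul_const, hIntg]
  have hsumint : ∀ i s t, Integrable (fun b => ∑ x, a' (Function.update b i s) x * v i t x)
      (Measure.pi Dh) := fun i s t =>
    integrable_finsetSum _ fun x _ => (haint i s x).mul_const _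
  refine ⟨mkMech a' p ha ha0 ha1 hpm, ?_, ?_, ?_⟩
  · intro t ht i
    unfold util
    rw [mkMech_alloc, mkMech_pay]
    have h1 := hUo i (t i) (ht i)
    have h2 := hv0 i (t i) (ht i) (emptyAlloc n m)
    simp only [hp]; linarith
  · have hins : ∀ i t s, interim v (mkMech a' p ha ha0 ha1 hpm) Dh i t (some s)
        = ∑ x, (κ * Xt i s x + Y i x) * v i t x - κ * qt i s + (1 - κ) * W := by
      intro i t s
      rw [interim_some]
      unfold util
      simp_rw [mkMech_alloc, mkMech_pay]
      simp only [hp, Function.update_self]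
      have hI2 : Integrable (fun b => ∑ x, a' (Function.update b i s) x * v i s x - U i s)
          (Measure.pi Dh) := (hsumint i s s).sub (integrable_const _)
      rw [integral_sub (hsumint i s t) hI2,
        integral_sub (hsumint i s s) (integrable_const _), hsum, hsum]
      simp only [integral_const, probReal_univ, smul_eq_mul, hU]
      ring
    intro i t ht bid _
    have htb := msupport_sub_box H (Dh i) (hDh i) ht
    rw [hins i t t, add_zero]
    cases bid with
    | none => rw [interim_none]; exact hUo i t htb
    | some s =>
      rw [hins i t s, hsplit, hsplit]
      nlinarith [mul_le_mul_of_nonneg_left (hBIC i t s) hκ0]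
  · unfold RevT
    simp_rw [mkMech_pay]
    have hUint : ∀ i, Integrable (U i) (Dh i) := by
      intro i
      refine Integrable.of_bound (C := ∑ x, (κ + Y i x) * W + κ * B i + (1 - κ) * W)
        (hUm i).aestronglyMeasurable ?_
      filter_upwards [box_ae H (Dh i) (hDh i)] with t ht
      rw [Real.norm_eq_abs]
      simp only [hU]
      have h1 : 0 ≤ ∑ x, (κ * Xt i t x + Y i x) * v i t x := Finset.sum_nonneg fun x _ =>
        mul_nonneg (add_nonneg (mul_nonneg hκ0 (hX0 i t x)) (hY i x)) (hv0 i t ht x)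
      have h2 : ∑ x, (κ * Xt i t x + Y i x) * v i t x ≤ ∑ x, (κ + Y i x) * W :=
        Finset.sum_le_sum fun x _ => mul_le_mul
          (by nlinarith [hXle i t x]) (hvW i t ht x) (hv0 i t ht x) (add_nonneg hκ0 (hY i x))
      have h3 := abs_le.1 (hqB i t)
      have h4 : κ * qt i t ≤ κ * B i := mul_le_mul_of_nonneg_left h3.2 hκ0
      have h5 : κ * (-B i) ≤ κ * qt i t := mul_le_mul_of_nonneg_left h3.1 hκ0
      have h6 : 0 ≤ (1 - κ) * W := mul_nonneg (by linarith) hW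
      exact abs_le.2 ⟨by linarith, by linarith⟩
    have hpint : ∀ i, Integrable (fun b => p b i) (Measure.pi Dh) := by
      intro i
      have h1 : Integrable (fun b : Fin n → Fin m → ℝ => ∑ x, a' b x * v i (b i) x)
          (Measure.pi Dh) := by
        refine Integrable.of_bound (C := W) (Finset.measurable_sum _ fun x _ =>
          (ha x).mul ((hvm i x).comp (measurable_pi_apply i))).aestronglyMeasurable ?_
        filter_upwards [box_ae_pi H Dh hDh] with b hb
        rw [Real.norm_eq_abs, abs_of_nonneg (Finset.sum_nonneg fun x _ =>
          mul_nonneg (ha0 b x) (hv0 i _ (hb i) x))]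
        exact simplex_sum_le _ _ W (ha0 b) (ha1 b) (hvW i _ (hb i))
      have h2 : Integrable (fun b : Fin n → Fin m → ℝ => U i (b i)) (Measure.pi Dh) :=
        (measurePreserving_eval Dh i).integrable_comp_of_integrable (hUint i)
      exact h1.sub h2
    rw [integral_finsetSum _ fun i _ => hpint i]
    refine Finset.sum_congr rfl fun i _ => ?_
    rw [integral_upd Dh i _ (hpint i)]
    congr 1
    funext s
    simp only [hp, Function.update_self]
    rw [integral_sub (hsumint i s s) (integrable_const _), hsum]
    simp only [integral_const, probReal_univ, smul_eq_mul, hU]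
    ring

/-- Interim form of the given mechanism. -/
lemma interim_facts (H W : ℝ) (v : Fin n → (Fin m → ℝ) → Alloc n m → ℝ)
    (D : Fin n → Measure (Fin m → ℝ)) [∀ i, IsProbabilityMeasure (D i)]
    (hD : ∀ i, suppBox H (D i)) (M : Mechanism n m) (hBIC : IsBIC 0 H v M D) (i : Fin n)
    (hpi : Integrable (fun b => M.pay (fun j => some (b j)) i) (Measure.pi D)) :
    ∃ S : Set (Fin m → ℝ), MeasurableSet S ∧ D i Sᶜ = 0 ∧ S ⊆ box m H ∧
      (∀ t ∈ S, ∀ s ∈ S,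
        ∑ x, (∫ b, M.allocProb (fun j => some (Function.update b i s j)) x ∂(Measure.pi D)) * v i t x
          - ∫ b, M.pay (fun j => some (Function.update b i s j)) i ∂(Measure.pi D)
        ≤ ∑ x, (∫ b, M.allocProb (fun j => some (Function.update b i t j)) x ∂(Measure.pi D)) * v i t x
          - ∫ b, M.pay (fun j => some (Function.update b i t j)) i ∂(Measure.pi D)) ∧
      (∀ t ∈ S, v i t (emptyAlloc n m)
        ≤ ∑ x, (∫ b, M.allocProb (fun j => some (Function.update b i t j)) x ∂(Measure.pi D)) * v i t x
          - ∫ b, M.pay (fun j => some (Function.update b i t j)) i ∂(Measure.pi D)) := by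
  set G : Set (Fin m → ℝ) := {s | Integrable
    (fun b => M.pay (fun j => some (Function.update b i s j)) i) (Measure.pi D)} with hG
  have hpm : Measurable fun p : (Fin m → ℝ) × (Fin n → Fin m → ℝ) =>
      M.pay (fun j => some (Function.update p.2 i p.1 j)) i :=
    (M.meas_pay i).comp (measurable_allSome.comp (measurable_upd i))
  have hGm : MeasurableSet G := measurableSet_integrable hpm.stronglyMeasurable
  have hGae : D i Gᶜ = 0 := by
    have h1 := (integrable_upd D i _ hpi).prod_right_ae
    rw [ae_iff] at h1
    exact h1
  have hsm : MeasurableSet (msupport (D i)) := by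
    rw [msupport_eq]; exact Measure.isClosed_support.measurableSet
  have hsc : D i (msupport (D i))ᶜ = 0 := by
    rw [msupport_eq]; exact Measure.measure_compl_support
  have haint : ∀ s x, Integrable (fun b => M.allocProb (fun j => some (Function.update b i s j)) x)
      (Measure.pi D) := fun s x =>
    Integrable.of_bound ((M.meas_allocProb x).comp
      (measurable_allSome.comp (measurable_upd_left i s))).aestronglyMeasurable 1
      (Filter.Eventually.of_forall fun b => by
        rw [Real.norm_eq_abs, abs_of_nonneg (M.allocProb_nonneg _ _),
          ← M.allocProb_sum_one (fun j => some (Function.update b i s j))]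
        exact Finset.single_le_sum (fun y _ => M.allocProb_nonneg _ y) (Finset.mem_univ x))
  have hin : ∀ t, ∀ s ∈ G, interim v M D i t (some s) =
      ∑ x, (∫ b, M.allocProb (fun j => some (Function.update b i s j)) x ∂(Measure.pi D)) * v i t x
          - ∫ b, M.pay (fun j => some (Function.update b i s j)) i ∂(Measure.pi D) := by
    intro t s hs
    rw [interim_some]
    unfold util
    rw [integral_sub (integrable_finsetSum _ fun x _ => (haint s x).mul_const _) hs,
      integral_finsetSum _ fun x _ => (haint s x).mul_const _]
    simp_rw [integral_mul_const]
  refine ⟨msupport (D i) ∩ G, hsm.inter hGm, ?_, fun t ht =>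
    msupport_sub_box H (D i) (hD i) ht.1, ?_, ?_⟩
  · rw [compl_inter]; exact measure_union_null hsc hGae
  · intro t ht s hs
    rw [← hin t s hs.2, ← hin t t ht.2]
    have := hBIC i t ht.1 (some s) (by
      intro s' hs'
      simp only [Option.mem_def, Option.some.injEq] at hs'
      subst hs'
      exact msupport_sub_box H (D i) (hD i) hs.1)
    linarith
  · intro t ht
    rw [← hin t t ht.2, ← interim_none v M D i t]
    have := hBIC i t ht.1 none (by simp)
    linarith

theorem one_side (H W ε : ℝ) (hW : 0 ≤ W) (hε : 0 < ε)
    (v : Fin n → (Fin m → ℝ) → Alloc n m → ℝ)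
    (hvm : ∀ i x, Measurable fun t => v i t x)
    (hv0 : ∀ i, ∀ t ∈ box m H, ∀ x, 0 ≤ v i t x) (hvW : ∀ i, ∀ t ∈ box m H, ∀ x, v i t x ≤ W)
    (D Dh : Fin n → Measure (Fin m → ℝ)) [∀ i, IsProbabilityMeasure (D i)]
    [∀ i, IsProbabilityMeasure (Dh i)]
    (hD : ∀ i, suppBox H (D i)) (hDh : ∀ i, suppBox H (Dh i))
    (hTV : ∀ i, TVLe (D i) (Dh i) ε) (hn : n * ε ≤ 1 / 2)
    (M : Mechanism n m) (hIR : IsIR H v M) (hBIC : IsBIC 0 H v M D) :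
    ∃ M' : Mechanism n m, IsIR H v M' ∧ IsBIC 0 H v M' Dh ∧
      RevT M D ≤ RevT M' Dh + 5 * (n * W) * (n * ε) := by
  have hnW : 0 ≤ (n : ℝ) * W := by positivity
  by_cases hpos : RevT M D ≤ 0
  · obtain ⟨M', h1, h2, h3⟩ := zero_mech H v hv0 Dh
    refine ⟨M', h1, h2, ?_⟩
    rw [h3]
    have : 0 ≤ 5 * (n * W) * (n * ε) := by positivity
    linarith
  push Not at hpos
  have hsumint : Integrable (fun b => ∑ i, M.pay (fun j => some (b j)) i) (Measure.pi D) := by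
    by_contra hni
    unfold RevT at hpos
    rw [integral_undef hni] at hpos
    exact lt_irrefl _ hpos
  have hpaym : ∀ i, Measurable fun b : Fin n → Fin m → ℝ => M.pay (fun j => some (b j)) i :=
    fun i => (M.meas_pay i).comp measurable_allSome
  have hpint : ∀ i, Integrable (fun b => M.pay (fun j => some (b j)) i) (Measure.pi D) := by
    intro i
    refine Integrable.mono' (g := fun b => |∑ i, M.pay (fun j => some (b j)) i| + n * W)
      (hsumint.abs.add (integrable_const _)) (hpaym i).aestronglyMeasurable ?_
    filter_upwards [box_ae_pi H D hD] with b hb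
    have h1 := fun k => pay_le H W v hvW M hIR b hb k
    have hn1 : (1 : ℝ) ≤ n := by
      have : 0 < n := i.pos
      exact_mod_cast this
    have h2 : ∑ k ∈ Finset.univ.erase i, M.pay (fun j => some (b j)) k ≤ n * W := by
      calc ∑ k ∈ Finset.univ.erase i, M.pay (fun j => some (b j)) k
          ≤ ∑ _k ∈ Finset.univ.erase i, W := Finset.sum_le_sum fun k _ => h1 k
        _ ≤ ∑ _k : Fin n, W := Finset.sum_le_sum_of_subset_of_nonneg (Finset.erase_subset _ _)
            fun _ _ _ => hW
        _ = n * W := by simp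
    have h3 := Finset.add_sum_erase Finset.univ (fun k => M.pay (fun j => some (b j)) k)
      (Finset.mem_univ i)
    have h4 := neg_abs_le (∑ i, M.pay (fun j => some (b j)) i)
    have h5 := abs_nonneg (∑ i, M.pay (fun j => some (b j)) i)
    have h6 : W ≤ n * W := by nlinarith
    rw [Real.norm_eq_abs]
    exact abs_le.2 ⟨by linarith, by linarith [h1 i]⟩
  choose S hSm hS0 hSb hSbic hSir using fun i => interim_facts H W v D hD M hBIC i (hpint i)
  set Xi : Fin n → (Fin m → ℝ) → Alloc n m → ℝ := fun i s x =>
    ∫ b, M.allocProb (fun j => some (Function.update b i s j)) x ∂(Measure.pi D) with hXi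
  set q : Fin n → (Fin m → ℝ) → ℝ := fun i s =>
    ∫ b, M.pay (fun j => some (Function.update b i s j)) i ∂(Measure.pi D) with hq
  have ham : ∀ x, Measurable fun b : Fin n → Fin m → ℝ => M.allocProb (fun j => some (b j)) x :=
    fun x => (M.meas_allocProb x).comp measurable_allSome
  have hXim : ∀ i x, Measurable fun t => Xi i t x := fun i x => by
    have : StronglyMeasurable (Function.uncurry fun (r : Fin m → ℝ) (b : Fin n → Fin m → ℝ) =>
        M.allocProb (fun j => some (Function.update b i r j)) x) :=
      ((ham x).comp (measurable_upd i)).stronglyMeasurable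
    exact this.integral_prod_right.measurable
  have hqm : ∀ i, Measurable (q i) := fun i => by
    have : StronglyMeasurable (Function.uncurry fun (r : Fin m → ℝ) (b : Fin n → Fin m → ℝ) =>
        M.pay (fun j => some (Function.update b i r j)) i) :=
      ((hpaym i).comp (measurable_upd i)).stronglyMeasurable
    exact this.integral_prod_right.measurable
  have hXi0 : ∀ i t x, 0 ≤ Xi i t x := fun i t x => integral_nonneg fun b => M.allocProb_nonneg _ _
  have hXi1 : ∀ i t, ∑ x, Xi i t x = 1 := fun i t => by
    have := integral_simplex (Measure.pi D)
      (fun b => M.allocProb (fun j => some (Function.update b i t j)))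
      (fun x => (ham x).comp (measurable_upd_left i t)) (fun b => M.allocProb_nonneg _)
      (fun b => M.allocProb_sum_one _)
    simpa using this
  have hSne : ∀ i, (S i).Nonempty := fun i => by
    by_contra hne
    rw [not_nonempty_iff_eq_empty] at hne
    have := hS0 i
    rw [hne] at this
    simp at this
  choose Xt qt a0 B hXtm hXt0 hXt1 hqtm hXtS hqtS hbic hir hqa hqB hqW using fun i =>
    menu_ext (emptyAlloc n m) (S i) (hSm i) (hSne i) (Xi i) (hXim i) (hXi0 i) (hXi1 i) (q i) (hqm i)
      (v i) (hvm i) W (fun t ht => hv0 i t (hSb i ht)) (fun t ht => hvW i t (hSb i ht))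
      (hSbic i) (hSir i)
  obtain ⟨κ, hκl, hκ1, hκ0, a', ha'm, ha'0, ha'1, Y, hY, hY2⟩ :=
    alloc_transfer (emptyAlloc n m) D Dh ε (by simpa using hn) hTV S hSm hS0
      (fun b => M.allocProb (fun j => some (b j))) ham (fun b => M.allocProb_nonneg _)
      (fun b => M.allocProb_sum_one _) Xt hXtm hXt0 hXt1 hXtS
  rw [Fintype.card_fin] at hκl
  obtain ⟨M', h1, h2, h3⟩ := new_mech H W hW v hvm hv0 hvW Dh hDh κ hκ0 hκ1 a' ha'm ha'0 ha'1 Y hY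
    Xt hXtm hXt0 hXt1 qt hqtm B hqB hY2 hbic hir
  refine ⟨M', h1, h2, ?_⟩
  have hrev : RevT M D = ∑ i, ∫ t, qt i t ∂(D i) := by
    unfold RevT
    rw [integral_finsetSum _ fun i _ => hpint i]
    refine Finset.sum_congr rfl fun i _ => ?_
    rw [integral_upd D i _ (hpint i)]
    refine integral_congr_ae ?_
    have : ∀ᵐ t ∂(D i), t ∈ S i := by rw [ae_iff]; exact hS0 i
    filter_upwards [this] with t ht
    exact (hqtS i t ht).symm
  have hrev' : RevT M' Dh = κ * ∑ i, ∫ t, qt i t ∂(Dh i) - n * ((1 - κ) * W) := by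
    have : ∀ i, ∫ t, (κ * qt i t - (1 - κ) * W) ∂(Dh i)
        = κ * ∫ t, qt i t ∂(Dh i) - (1 - κ) * W := by
      intro i
      have hqi : Integrable (qt i) (Dh i) :=
        Integrable.of_bound (hqtm i).aestronglyMeasurable (B i)
          (Filter.Eventually.of_forall (hqB i))
      rw [integral_sub (hqi.const_mul _) (integrable_const _), integral_const_mul]
      simp
    rw [h3]
    simp_rw [this]
    rw [Finset.sum_sub_distrib, ← Finset.mul_sum]
    simp
  have hprice : ∑ i, ∫ t, qt i t ∂(D i) - n * (W * ε) ≤ ∑ i, ∫ t, qt i t ∂(Dh i) := by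
    have : ∑ i, (∫ t, qt i t ∂(D i) - W * ε) ≤ ∑ i, ∫ t, qt i t ∂(Dh i) :=
      Finset.sum_le_sum fun i _ => price_transfer (D i) (Dh i) ε (hTV i) (S i) (hS0 i) (qt i)
        (hqtm i) (a0 i) (B i) W hW (hqa i) (hqB i) (hqW i)
    rw [Finset.sum_sub_distrib] at this
    simpa using this
  have hle := rev_le H W hW v hvW M hIR D hD
  rw [← hrev] at hprice
  rw [hrev']
  have k1 := mul_le_mul_of_nonneg_left hprice hκ0
  have k2 : (1 - κ) * RevT M D ≤ (1 - κ) * (n * W) :=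
    mul_le_mul_of_nonneg_left hle (by linarith)
  have k3 : κ * (n * (W * ε)) ≤ n * (W * ε) := mul_le_of_le_one_left (by positivity) hκ1
  have k4 : (1 - κ) * (n * W) ≤ 2 * (n * ε) * (n * W) :=
    mul_le_mul_of_nonneg_right (by linarith) hnW
  have k5 : (n : ℝ) * (W * ε) ≤ (n * W) * (n * ε) := by
    rcases Nat.eq_zero_or_pos n with h0 | h0
    · subst h0; simp
    · have : (1 : ℝ) ≤ n := by exact_mod_cast h0
      have h5 : 0 ≤ (n : ℝ) * (W * ε) := by positivity
      nlinarith
  nlinarith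

lemma OPT_bdd (H W : ℝ) (hW : 0 ≤ W) (v : Fin n → (Fin m → ℝ) → Alloc n m → ℝ)
    (hvW : ∀ i, ∀ t ∈ box m H, ∀ x, v i t x ≤ W)
    (D : Fin n → Measure (Fin m → ℝ)) [∀ i, IsProbabilityMeasure (D i)]
    (hD : ∀ i, suppBox H (D i)) :
    (n * W) ∈ upperBounds {r | ∃ M : Mechanism n m, IsIR H v M ∧ IsBIC 0 H v M D ∧ r = RevT M D} := by
  rintro r ⟨M, h1, _, rfl⟩
  exact rev_le H W hW v hvW M h1 D hD

theorem opt_diff (H W ε : ℝ) (hW : 0 ≤ W) (hε : 0 < ε)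
    (v : Fin n → (Fin m → ℝ) → Alloc n m → ℝ)
    (hvm : ∀ i x, Measurable fun t => v i t x)
    (hv0 : ∀ i, ∀ t ∈ box m H, ∀ x, 0 ≤ v i t x) (hvW : ∀ i, ∀ t ∈ box m H, ∀ x, v i t x ≤ W)
    (D Dh : Fin n → Measure (Fin m → ℝ)) [∀ i, IsProbabilityMeasure (D i)]
    [∀ i, IsProbabilityMeasure (Dh i)]
    (hD : ∀ i, suppBox H (D i)) (hDh : ∀ i, suppBox H (Dh i))
    (hTV : ∀ i, TVLe (D i) (Dh i) ε) :
    OPT 0 H v D ≤ OPT 0 H v Dh + 5 * (n * W) * (n * ε) := by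
  have hnW : 0 ≤ (n : ℝ) * W := by positivity
  have hne : ∀ (D : Fin n → Measure (Fin m → ℝ)) [∀ i, IsProbabilityMeasure (D i)],
      (0 : ℝ) ∈ {r | ∃ M : Mechanism n m, IsIR H v M ∧ IsBIC 0 H v M D ∧ r = RevT M D} := by
    intro D _
    obtain ⟨M, h1, h2, h3⟩ := zero_mech H v hv0 D
    exact ⟨M, h1, h2, h3.symm⟩
  have hb := OPT_bdd H W hW v hvW Dh hDh
  refine csSup_le ⟨0, hne D⟩ ?_
  rintro r ⟨M, h1, h2, rfl⟩
  by_cases hn : n * ε ≤ 1 / 2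
  · obtain ⟨M', h3, h4, h5⟩ := one_side H W ε hW hε v hvm hv0 hvW D Dh hD hDh hTV hn M h1 h2
    have : RevT M' Dh ≤ OPT 0 H v Dh := le_csSup ⟨_, hb⟩ ⟨M', h3, h4, rfl⟩
    linarith
  · push Not at hn
    have h3 := rev_le H W hW v hvW M h1 D hD
    have h4 : 0 ≤ OPT 0 H v Dh := le_csSup ⟨_, hb⟩ (hne Dh)
    nlinarith

end MIAux

/-- TV-continuity of the optimal multi-item revenue: there is an absolute
constant `C` such that if each `Dᵢ`, `D̂ᵢ` is supported on `[0,H]^m` and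
`‖Dᵢ − D̂ᵢ‖_TV ≤ ε` for all `i`, then
`|OPT(D) − OPT(D̂)| ≤ C·nmLH·(nε + √(nε))`, where `OPT` is the optimal revenue over BIC
and IR mechanisms. -/
theorem stmt12 :
    ∃ C : ℝ, 0 < C ∧
      ∀ (n m : ℕ) (H L ε : ℝ), 0 < H → 0 < L → 0 < ε →
      ∀ v : Fin n → (Fin m → ℝ) → Alloc n m → ℝ,
        (∀ i t x, (∀ j, t j ∈ Icc (0:ℝ) H) → 0 ≤ v i t x) →
        (∀ i t x, (∀ j, t j ∈ Icc (0:ℝ) H) → v i t x ≤ m * L * H) →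
        (∀ i t t' x, |v i t x - v i t' x| ≤ L * ∑ j, |t j - t' j|) →
      ∀ D Dhat : Fin n → Measure (Fin m → ℝ),
        (∀ i, IsProbabilityMeasure (D i)) → (∀ i, suppBox H (D i)) →
        (∀ i, IsProbabilityMeasure (Dhat i)) → (∀ i, suppBox H (Dhat i)) →
        (∀ i, TVLe (D i) (Dhat i) ε) →
        |OPT 0 H v D - OPT 0 H v Dhat| ≤
          C * n * m * L * H * (n * ε + Real.sqrt (n * ε)) := by
  refine ⟨5, by norm_num, ?_⟩
  intro n m H L ε hH hL hε v hv0 hvW hvL D Dh hDp hD hDhp hDh hTV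
  have hW : 0 ≤ (m : ℝ) * L * H := by positivity
  have hvm : ∀ i x, Measurable fun t => v i t x := fun i x =>
    MIAux.val_measurable L _ fun t t' => hvL i t t' x
  have h1 := MIAux.opt_diff H (m * L * H) ε hW hε v hvm (fun i t ht x => hv0 i t x ht)
    (fun i t ht x => hvW i t x ht) D Dh hD hDh hTV
  have h2 := MIAux.opt_diff H (m * L * H) ε hW hε v hvm (fun i t ht x => hv0 i t x ht)
    (fun i t ht x => hvW i t x ht) Dh D hDh hD
    (fun i A hA => by rw [abs_sub_comm]; exact hTV i A hA)
  have h3 : 0 ≤ (n : ℝ) * (m * L * H) * Real.sqrt (n * ε) := by positivity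
  have h4 : 5 * (n : ℝ) * m * L * H * (n * ε + Real.sqrt (n * ε))
      = 5 * (n * (m * L * H)) * (n * ε) + 5 * (n * (m * L * H) * Real.sqrt (n * ε)) := by ring
  rw [h4]
  exact abs_le.2 ⟨by linarith, by linarith⟩
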